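/- arXiv:2211.11706 — 9 statements merged into one kernel-verified Lean document; each statement's English description precedes it below -/
import Mathlib

section
/- Let $\alpha \ge 0$ and $\kappa > 0$, and define $h(\xi,\lambda) = \dfrac{\xi\sqrt{\alpha\xi^2+1}}{\sqrt{\kappa\xi^4+\xi^2+1}} + \lambda\xi$. Set $\ell = 7$ and $\ell_0 = 6$ if $\kappa = \alpha$ or $\alpha = 0$, and $\ell = 9$ and $\ell_0 = 4$ if $\kappa \neq \alpha$ and $\alpha \neq 0$. Then there exist $\varepsilon_0 > 0$, $N_0 > 0$ and a constant $C > 0$ such that for all $\varepsilon \in (0, \varepsilon_0)$, all $N \ge N_0$, all $t > 0$ and all $\lambda \in \mathbb{R}$, $\left| \int_{-N}^{N} e^{i t h(\xi,\lambda)}\, d\xi \right| \le C \left( t^{-1/2} \max\{ N^{\ell_0/2}, \varepsilon^{-\ell/2} \} + \varepsilon \right)$. -/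
open Real

/-- The phase function of the linearized generalized Boussinesq equation. -/
noncomputable def gBqPhase (α κ lam ξ : ℝ) : ℝ :=
  ξ * Real.sqrt (α * ξ ^ 2 + 1) / Real.sqrt (κ * ξ ^ 4 + ξ ^ 2 + 1) + lam * ξ

theorem norm_integral_exp_le_of_deriv_ge {φ φ' φ'' : ℝ → ℝ}
    (h₁ : ∀ x, HasDerivAt φ (φ' x) x) (h₂ : ∀ x, HasDerivAt φ' (φ'' x) x)
    (hc : Continuous φ'') {a b δ : ℝ} (hab : a ≤ b) (hδ : 0 < δ)
    (hφ' : ∀ x ∈ Set.Icc a b, δ ≤ |φ' x|) (hφ'' : ∀ x ∈ Set.Icc a b, 0 ≤ φ'' x) :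
    ‖∫ x in a..b, Complex.exp (Complex.I * (φ x : ℂ))‖ ≤ 4 / δ := by
  have hne : ∀ x ∈ Set.uIcc a b, φ' x ≠ 0 := fun x hx h0 => by
    have := hφ' x (Set.uIcc_of_le hab ▸ hx)
    rw [h0, abs_zero] at this
    linarith
  have hcφ : Continuous φ := continuous_iff_continuousAt.2 fun x => (h₁ x).continuousAt
  have hcφ' : Continuous φ' := continuous_iff_continuousAt.2 fun x => (h₂ x).continuousAt
  have hexp : Continuous fun x => Complex.exp (Complex.I * (φ x : ℂ)) := by fun_prop
  have hg : ContinuousOn (fun x => φ'' x / φ' x ^ 2) (Set.uIcc a b) :=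
    hc.continuousOn.div (by fun_prop) fun x hx => pow_ne_zero 2 (hne x hx)
  have hgC : ContinuousOn (fun x => Complex.I * Complex.exp (Complex.I * (φ x : ℂ)) *
      ((φ'' x / φ' x ^ 2 : ℝ) : ℂ)) (Set.uIcc a b) :=
    (continuous_const.mul hexp).continuousOn.mul
      (Complex.continuous_ofReal.comp_continuousOn hg)
  have hF : ∀ x ∈ Set.uIcc a b,
      HasDerivAt (fun x => -Complex.I * Complex.exp (Complex.I * (φ x : ℂ)) * (((φ' x)⁻¹ : ℝ) : ℂ))
        (Complex.exp (Complex.I * (φ x : ℂ)) +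
          Complex.I * Complex.exp (Complex.I * (φ x : ℂ)) * ((φ'' x / φ' x ^ 2 : ℝ) : ℂ)) x := by
    intro x hx
    have hx0 : (φ' x : ℂ) ≠ 0 := by exact_mod_cast hne x hx
    have := ((((h₁ x).ofReal_comp.const_mul Complex.I).cexp).const_mul (-Complex.I)).mul
      ((h₂ x).inv (hne x hx)).ofReal_comp
    refine this.congr_deriv ?_
    rw [Pi.inv_apply]
    push_cast
    field_simp
    linear_combination (-(φ' x : ℂ) ^ 2) * Complex.I_sq
  have hint := intervalIntegral.integral_eq_sub_of_hasDerivAt hF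
    (hexp.continuousOn.add hgC).intervalIntegrable
  rw [intervalIntegral.integral_add (hexp.intervalIntegrable a b) hgC.intervalIntegrable] at hint
  have hinv : ∀ x ∈ Set.uIcc a b,
      HasDerivAt (fun x => -(φ' x)⁻¹) (φ'' x / φ' x ^ 2) x := fun x hx => by
    have := ((h₂ x).inv (hne x hx)).neg
    exact this.congr_deriv (by ring)
  have hint' := intervalIntegral.integral_eq_sub_of_hasDerivAt hinv hg.intervalIntegrable
  have hnorm : ‖∫ x in a..b, Complex.I * Complex.exp (Complex.I * (φ x : ℂ)) *
      ((φ'' x / φ' x ^ 2 : ℝ) : ℂ)‖ ≤ ∫ x in a..b, φ'' x / φ' x ^ 2 := by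
    refine intervalIntegral.norm_integral_le_of_norm_le hab ?_ hg.intervalIntegrable
    refine Filter.Eventually.of_forall fun x hx => ?_
    rw [norm_mul, norm_mul, Complex.norm_I, Complex.norm_exp_I_mul_ofReal, Complex.norm_real,
      Real.norm_of_nonneg (div_nonneg (hφ'' x ⟨hx.1.le, hx.2⟩) (sq_nonneg _))]
    simp
  have hbd : ∀ x ∈ Set.Icc a b, |(φ' x)⁻¹| ≤ 1 / δ := fun x hx => by
    rw [abs_inv, inv_eq_one_div]
    exact one_div_le_one_div_of_le hδ (hφ' x hx)
  have hbdF : ∀ x ∈ Set.Icc a b,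
      ‖-Complex.I * Complex.exp (Complex.I * (φ x : ℂ)) * (((φ' x)⁻¹ : ℝ) : ℂ)‖ ≤ 1 / δ := by
    intro x hx
    rw [norm_mul, norm_mul, norm_neg, Complex.norm_I, Complex.norm_exp_I_mul_ofReal,
      Complex.norm_real, Real.norm_eq_abs]
    simpa using hbd x hx
  have ha := Set.left_mem_Icc.2 hab
  have hb := Set.right_mem_Icc.2 hab
  rw [eq_sub_of_add_eq hint]
  refine (norm_sub_le _ _).trans ?_
  refine (add_le_add (norm_sub_le _ _) (hnorm.trans_eq hint')).trans ?_
  have e1 := hbdF a ha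
  have e2 := hbdF b hb
  have e3 := (abs_le.1 (hbd a ha)).2
  have e4 := (abs_le.1 (hbd b hb)).1
  have e5 : 4 / δ = 4 * (1 / δ) := by ring
  linarith

theorem norm_integral_le_of_norm_integral_off_ball_le {f : ℝ → ℂ} (hf : Continuous f)
    (hf1 : ∀ x, ‖f x‖ ≤ 1) {a b c η A : ℝ} (hab : a ≤ b) (hη : 0 ≤ η) (hA : 0 ≤ A)
    (h : ∀ x y, a ≤ x → x ≤ y → y ≤ b → (∀ z ∈ Set.Icc x y, η ≤ |z - c|) →
      ‖∫ z in x..y, f z‖ ≤ A) :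
    ‖∫ z in a..b, f z‖ ≤ 2 * A + 2 * η := by
  have hi : ∀ x y, IntervalIntegrable f MeasureTheory.volume x y := hf.intervalIntegrable
  set p := max a (min b (c - η)) with hp
  set q := max a (min b (c + η)) with hq
  have hap : a ≤ p := le_max_left _ _
  have hpb : p ≤ b := max_le hab (min_le_left _ _)
  have haq : a ≤ q := le_max_left _ _
  have hqb : q ≤ b := max_le hab (min_le_left _ _)
  have hpq : p ≤ q := max_le_max le_rfl (min_le_min le_rfl (by linarith))
  have hqp : q - p ≤ 2 * η := by
    have : q ≤ p + 2 * η := by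
      refine max_le (by linarith) ?_
      have : min b (c - η) ≤ p := le_max_right _ _
      rcases le_total b (c - η) with hb | hb
      · rw [min_eq_left hb] at this
        linarith [min_le_left b (c + η)]
      · rw [min_eq_right hb] at this
        linarith [min_le_right b (c + η)]
    linarith
  have h1 : ‖∫ z in a..p, f z‖ ≤ A := by
    rcases hap.eq_or_lt with h0 | h0
    · rw [← h0]; simpa using hA
    · refine h a p le_rfl hap hpb fun z hz => ?_
      have : p ≤ c - η := by
        rcases max_choice a (min b (c - η)) with h' | h'
        · exact absurd (hp.trans h') h0.ne'
        · exact (hp.trans h').le.trans (min_le_right _ _)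
      rw [abs_sub_comm]
      exact le_trans (by linarith [hz.2]) (le_abs_self _)
  have h3 : ‖∫ z in q..b, f z‖ ≤ A := by
    rcases hqb.eq_or_lt with h0 | h0
    · rw [h0]; simpa using hA
    · refine h q b haq hqb le_rfl fun z hz => ?_
      have : c + η ≤ q := by
        have h' : min b (c + η) < b := lt_of_le_of_lt (le_max_right _ _) h0
        have h'' : min b (c + η) = c + η := by
          rcases min_choice b (c + η) with h1 | h1
          · exact absurd h1 h'.ne
          · exact h1
        exact h'' ▸ le_max_right a (min b (c + η))
      exact le_trans (by linarith [hz.1]) (le_abs_self _)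
  have h2 : ‖∫ z in p..q, f z‖ ≤ 2 * η := by
    have := intervalIntegral.norm_integral_le_of_norm_le_const (a := p) (b := q)
      fun x _ => hf1 x
    rw [abs_of_nonneg (by linarith)] at this
    linarith
  rw [← intervalIntegral.integral_add_adjacent_intervals (hi a p) (hi p b),
    ← intervalIntegral.integral_add_adjacent_intervals (hi p q) (hi q b)]
  have := norm_add_le (∫ z in a..p, f z) ((∫ z in p..q, f z) + ∫ z in q..b, f z)
  have := norm_add_le (∫ z in p..q, f z) (∫ z in q..b, f z)
  linarith

theorem norm_integral_exp_le_of_deriv2_ge {φ φ' φ'' : ℝ → ℝ}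
    (h₁ : ∀ x, HasDerivAt φ (φ' x) x) (h₂ : ∀ x, HasDerivAt φ' (φ'' x) x)
    (hc : Continuous φ'') {a b ρ : ℝ} (hab : a ≤ b) (hρ : 0 < ρ)
    (hφ'' : ∀ x ∈ Set.Icc a b, ρ ≤ φ'' x) :
    ‖∫ x in a..b, Complex.exp (Complex.I * (φ x : ℂ))‖ ≤ 10 / √ρ := by
  have hcφ : Continuous φ := continuous_iff_continuousAt.2 fun x => (h₁ x).continuousAt
  have hcφ' : Continuous φ' := continuous_iff_continuousAt.2 fun x => (h₂ x).continuousAt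
  have hmono : ∀ x ∈ Set.Icc a b, ∀ y ∈ Set.Icc a b, x ≤ y → ρ * (y - x) ≤ φ' y - φ' x :=
    (convex_Icc a b).mul_sub_le_image_sub_of_le_deriv hcφ'.continuousOn
      (fun x _ => (h₂ x).differentiableAt.differentiableWithinAt)
      fun x hx => (h₂ x).deriv ▸ hφ'' x (interior_subset hx)
  have ha := Set.left_mem_Icc.2 hab
  have hb := Set.right_mem_Icc.2 hab
  obtain ⟨c, hcc⟩ : ∃ c, ∀ x ∈ Set.Icc a b, ρ * |x - c| ≤ |φ' x| := by
    rcases le_or_gt 0 (φ' a) with h0 | h0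
    · refine ⟨a, fun x hx => ?_⟩
      rw [abs_of_nonneg (sub_nonneg.2 hx.1)]
      exact le_trans (by linarith [hmono a ha x hx hx.1]) (le_abs_self _)
    rcases le_or_gt (φ' b) 0 with h0' | h0'
    · refine ⟨b, fun x hx => ?_⟩
      rw [abs_sub_comm, abs_of_nonneg (sub_nonneg.2 hx.2)]
      exact le_trans (by linarith [hmono x hx b hb hx.2]) (neg_le_abs _)
    · obtain ⟨c, hc, hc0⟩ := intermediate_value_Icc hab hcφ'.continuousOn ⟨h0.le, h0'.le⟩
      refine ⟨c, fun x hx => ?_⟩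
      rcases le_total c x with h | h
      · rw [abs_of_nonneg (sub_nonneg.2 h)]
        exact le_trans (by linarith [hmono c hc x hx h]) (le_abs_self _)
      · rw [abs_sub_comm, abs_of_nonneg (sub_nonneg.2 h)]
        exact le_trans (by linarith [hmono x hx c hc h]) (neg_le_abs _)
  have hs : 0 < √ρ := Real.sqrt_pos.2 hρ
  have := norm_integral_le_of_norm_integral_off_ball_le
    (f := fun x => Complex.exp (Complex.I * (φ x : ℂ))) (by fun_prop)
    (fun x => (Complex.norm_exp_I_mul_ofReal _).le) (c := c) (η := 1 / √ρ) (A := 4 / √ρ)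
    hab (by positivity) (by positivity) fun x y hx hxy hy hz => by
      refine norm_integral_exp_le_of_deriv_ge h₁ h₂ hc hxy hs (fun z hzm => ?_)
        fun z hzm => hρ.le.trans (hφ'' z ⟨hx.trans hzm.1, hzm.2.trans hy⟩)
      refine le_trans ?_ (hcc z ⟨hx.trans hzm.1, hzm.2.trans hy⟩)
      refine le_trans (le_of_eq ?_) (mul_le_mul_of_nonneg_left (hz z hzm) hρ.le)
      field_simp
      exact Real.sq_sqrt hρ.le
  refine this.trans (le_of_eq ?_)
  ring

/-- Van der Corput's lemma for the second derivative. -/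
theorem norm_integral_exp_le_of_abs_deriv2_ge {φ φ' φ'' : ℝ → ℝ}
    (h₁ : ∀ x, HasDerivAt φ (φ' x) x) (h₂ : ∀ x, HasDerivAt φ' (φ'' x) x)
    (hc : Continuous φ'') {a b ρ : ℝ} (hab : a ≤ b) (hρ : 0 < ρ)
    (hφ'' : ∀ x ∈ Set.Icc a b, ρ ≤ |φ'' x|) :
    ‖∫ x in a..b, Complex.exp (Complex.I * (φ x : ℂ))‖ ≤ 10 / √ρ := by
  rcases isPreconnected_Icc.mapsTo_Ioi_or_Iio (hc.continuousOn (s := Set.Icc a b)) (b := 0)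
    fun x hx h0 => by have := hφ'' x hx; rw [h0, abs_zero] at this; linarith with h | h
  · exact norm_integral_exp_le_of_deriv2_ge h₁ h₂ hc hab hρ fun x hx =>
      (hφ'' x hx).trans_eq (abs_of_pos (h hx))
  · have := norm_integral_exp_le_of_deriv2_ge (fun x => (h₁ x).neg) (fun x => (h₂ x).neg) hc.neg
      hab hρ fun x hx => (hφ'' x hx).trans_eq (abs_of_neg (h hx))
    rw [← RCLike.norm_conj]
    convert! this using 2
    rw [intervalIntegral.integral_of_le hab, intervalIntegral.integral_of_le hab, ← integral_conj]
    congr 1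
    ext x
    rw [← Complex.exp_conj]
    simp

theorem norm_integral_exp_le_of_abs_deriv2_ge_off_balls {φ φ' φ'' : ℝ → ℝ}
    (h₁ : ∀ x, HasDerivAt φ (φ' x) x) (h₂ : ∀ x, HasDerivAt φ' (φ'' x) x)
    (hc : Continuous φ'') {η ρ : ℝ} (hη : 0 ≤ η) (hρ : 0 < ρ) (S : Multiset ℝ) :
    ∀ {a b : ℝ}, a ≤ b →
      (∀ x ∈ Set.Icc a b, (∀ s ∈ S, η ≤ |x - s|) → ρ ≤ |φ'' x|) →
      ‖∫ x in a..b, Complex.exp (Complex.I * (φ x : ℂ))‖ ≤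
        2 ^ S.card * (10 / √ρ + 2 * η) - 2 * η := by
  have hcφ : Continuous φ := continuous_iff_continuousAt.2 fun x => (h₁ x).continuousAt
  induction S using Multiset.induction with
  | empty =>
    intro a b hab h
    simpa using norm_integral_exp_le_of_abs_deriv2_ge h₁ h₂ hc hab hρ
      fun x hx => h x hx (by simp)
  | cons s S ih =>
    intro a b hab h
    have hA : 0 ≤ 2 ^ S.card * (10 / √ρ + 2 * η) - 2 * η := by
      have h1 : (1 : ℝ) ≤ 2 ^ S.card := one_le_pow₀ (by norm_num)
      have h2 : 0 ≤ 10 / √ρ := by positivity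
      nlinarith
    refine (norm_integral_le_of_norm_integral_off_ball_le (by fun_prop)
      (fun x => (Complex.norm_exp_I_mul_ofReal _).le) (c := s) hab hη hA
      fun x y hx hxy hy hz => ih hxy fun z hzm hzS =>
        h z ⟨hx.trans hzm.1, hzm.2.trans hy⟩ fun r hr => ?_).trans (le_of_eq ?_)
    · rcases Multiset.mem_cons.1 hr with rfl | hr
      · exact hz z hzm
      · exact hzS r hr
    · rw [Multiset.card_cons, pow_succ]
      ring

theorem Polynomial.exists_multiset_prod_abs_sub_le_abs_eval (q : Polynomial ℝ) :
    ∃ S : Multiset ℝ, S.card = q.natDegree ∧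
      ∀ x : ℝ, |q.leadingCoeff| * (S.map fun s => |x - s|).prod ≤ |q.eval x| := by
  have hs := IsAlgClosed.splits (q.map (algebraMap ℝ ℂ))
  refine ⟨(q.map (algebraMap ℝ ℂ)).roots.map Complex.re, ?_, fun x => ?_⟩
  · rw [Multiset.card_map, ← hs.natDegree_eq_card_roots, Polynomial.natDegree_map]
  · have h := congrArg norm (hs.eval_eq_prod_roots (x : ℂ))
    have h0 : Polynomial.eval (x : ℂ) (q.map (algebraMap ℝ ℂ)) = ((q.eval x : ℝ) : ℂ) := by
      rw [Polynomial.eval_map_algebraMap]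
      exact Polynomial.aeval_algebraMap_apply_eq_algebraMap_eval x q
    rw [h0, Complex.norm_real, Real.norm_eq_abs, norm_mul, Polynomial.leadingCoeff_map] at h
    have hp := map_multiset_prod (normHom : ℂ →*₀ ℝ)
      ((q.map (algebraMap ℝ ℂ)).roots.map fun z => (x : ℂ) - z)
    rw [Multiset.map_map] at hp
    simp only [normHom_apply] at hp
    rw [h, Complex.coe_algebraMap, Complex.norm_real, Real.norm_eq_abs, hp, Multiset.map_map]
    refine mul_le_mul_of_nonneg_left ?_ (abs_nonneg _)
    refine Multiset.prod_map_le_prod_map₀ _ _ (fun z _ => abs_nonneg (x - z.re)) fun z _ => ?_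
    simpa using Complex.abs_re_le_norm (x - z)

theorem Multiset.pow_card_le_prod_map {S : Multiset ℝ} {f : ℝ → ℝ} {r : ℝ} (hr : 0 ≤ r)
    (h : ∀ s ∈ S, r ≤ f s) : r ^ S.card ≤ (S.map f).prod := by
  have := Multiset.prod_map_le_prod_map₀ (s := S) (fun _ => r) f (fun _ _ => hr) h
  simpa using this

/-- The numerator of the second derivative of the phase. -/
noncomputable def gBqNum (α κ : ℝ) : Polynomial ℝ :=
  .C (-3 * α * κ * (α - κ)) * .X ^ 9 + .C (-2 * κ * (α - κ) - 10 * α ^ 2 * κ) * .X ^ 7 +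
    .C ((α - κ) * (3 * α + 1) - 4 * α ^ 2 - 15 * α * κ) * .X ^ 5 +
    .C (4 * (α - κ) + 2 * α ^ 2 - 6 * α - 6 * κ) * .X ^ 3 + .C (3 * α - 3) * .X

theorem natDegree_gBqNum_of_ne {α κ : ℝ} (hκ : κ ≠ 0) (hα : α ≠ 0) (h : κ ≠ α) :
    (gBqNum α κ).natDegree = 9 := by
  unfold gBqNum
  compute_degree!
  exact ⟨⟨hα, hκ⟩, sub_ne_zero.2 h.symm⟩

theorem natDegree_gBqNum_of_eq {α κ : ℝ} (hκ : κ ≠ 0) (h : κ = α ∨ α = 0) :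
    (gBqNum α κ).natDegree = 7 := by
  have h9 : -3 * α * κ * (α - κ) = 0 := by rcases h with rfl | rfl <;> ring
  have h7 : -2 * κ * (α - κ) - 10 * α ^ 2 * κ ≠ 0 := by
    rcases h with rfl | rfl
    · have : -2 * κ * (κ - κ) - 10 * κ ^ 2 * κ = -10 * κ ^ 3 := by ring
      rw [this]
      simp [hκ]
    · have : -2 * κ * (0 - κ) - 10 * 0 ^ 2 * κ = 2 * κ ^ 2 := by ring
      rw [this]
      simp [hκ]
  unfold gBqNum
  rw [h9, Polynomial.C_0, zero_mul, zero_add]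
  compute_degree!
  exact fun h0 => h7 (by linarith)

/-- The derivative of the phase. -/
noncomputable def gBqPhaseDeriv (α κ lam x : ℝ) : ℝ :=
  ((α - κ) * x ^ 4 + 2 * α * x ^ 2 + 1) /
    (√(α * x ^ 2 + 1) * √(κ * x ^ 4 + x ^ 2 + 1) ^ 3) + lam

/-- The second derivative of the phase. -/
noncomputable def gBqPhaseDeriv2 (α κ x : ℝ) : ℝ :=
  (gBqNum α κ).eval x / (√(α * x ^ 2 + 1) ^ 3 * √(κ * x ^ 4 + x ^ 2 + 1) ^ 5)

theorem hasDerivAt_gBqPhase {α κ : ℝ} (hα : 0 ≤ α) (hκ : 0 < κ)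
    (lam x : ℝ) :
    HasDerivAt (gBqPhase α κ lam) (gBqPhaseDeriv α κ lam x) x := by
  have hu : 0 < α * x ^ 2 + 1 := by positivity
  have hQ : 0 < κ * x ^ 4 + x ^ 2 + 1 := by positivity
  have du : HasDerivAt (fun x => α * x ^ 2 + 1) (2 * α * x) x :=
    (((hasDerivAt_pow 2 x).const_mul α).add_const 1).congr_deriv (by push_cast; ring)
  have dQ : HasDerivAt (fun x => κ * x ^ 4 + x ^ 2 + 1) (4 * κ * x ^ 3 + 2 * x) x :=
    ((((hasDerivAt_pow 4 x).const_mul κ).add (hasDerivAt_pow 2 x)).add_const 1).congr_deriv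
      (by push_cast; ring)
  have := (((hasDerivAt_id x).mul (du.sqrt hu.ne')).div (dQ.sqrt hQ.ne')
    (Real.sqrt_pos.2 hQ).ne').add ((hasDerivAt_id x).const_mul lam)
  refine this.congr_deriv ?_
  simp only [gBqPhaseDeriv, Pi.mul_apply, id]
  have hU := Real.sqrt_pos.2 hu
  have hV := Real.sqrt_pos.2 hQ
  have eU := Real.sq_sqrt hu.le
  have eV := Real.sq_sqrt hQ.le
  generalize √(α * x ^ 2 + 1) = U at *
  generalize √(κ * x ^ 4 + x ^ 2 + 1) = V at *
  field_simp
  simp only [eU, eV]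
  ring

theorem hasDerivAt_gBqPhaseDeriv {α κ : ℝ} (hα : 0 ≤ α) (hκ : 0 < κ)
    (lam x : ℝ) :
    HasDerivAt (gBqPhaseDeriv α κ lam) (gBqPhaseDeriv2 α κ x) x := by
  have hu : 0 < α * x ^ 2 + 1 := by positivity
  have hQ : 0 < κ * x ^ 4 + x ^ 2 + 1 := by positivity
  have du : HasDerivAt (fun x => α * x ^ 2 + 1) (2 * α * x) x :=
    (((hasDerivAt_pow 2 x).const_mul α).add_const 1).congr_deriv (by push_cast; ring)
  have dQ : HasDerivAt (fun x => κ * x ^ 4 + x ^ 2 + 1) (4 * κ * x ^ 3 + 2 * x) x :=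
    ((((hasDerivAt_pow 4 x).const_mul κ).add (hasDerivAt_pow 2 x)).add_const 1).congr_deriv
      (by push_cast; ring)
  have dA : HasDerivAt (fun x => (α - κ) * x ^ 4 + 2 * α * x ^ 2 + 1)
      (4 * (α - κ) * x ^ 3 + 4 * α * x) x :=
    ((((hasDerivAt_pow 4 x).const_mul (α - κ)).add
      ((hasDerivAt_pow 2 x).const_mul (2 * α))).add_const 1).congr_deriv (by push_cast; ring)
  have hU := Real.sqrt_pos.2 hu
  have hV := Real.sqrt_pos.2 hQ
  have := (dA.div ((du.sqrt hu.ne').mul ((dQ.sqrt hQ.ne').pow 3))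
    (by simp only [Pi.mul_apply, Pi.pow_apply]; positivity)).add_const lam
  refine this.congr_deriv ?_
  simp only [gBqPhaseDeriv2, gBqNum, Pi.mul_apply, Pi.pow_apply, Polynomial.eval_add,
    Polynomial.eval_mul, Polynomial.eval_C, Polynomial.eval_pow, Polynomial.eval_X]
  have eU := Real.sq_sqrt hu.le
  have eV := Real.sq_sqrt hQ.le
  have eV4 : √(κ * x ^ 4 + x ^ 2 + 1) ^ 4 = (κ * x ^ 4 + x ^ 2 + 1) ^ 2 := by
    rw [show 4 = 2 * 2 from rfl, pow_mul, eV]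
  generalize √(α * x ^ 2 + 1) = U at *
  generalize √(κ * x ^ 4 + x ^ 2 + 1) = V at *
  field_simp
  simp only [eU, eV, eV4]
  push_cast
  ring

theorem continuous_gBqPhaseDeriv2 {α κ : ℝ} (hα : 0 ≤ α) (hκ : 0 < κ) :
    Continuous (gBqPhaseDeriv2 α κ) := by
  unfold gBqPhaseDeriv2
  refine (gBqNum α κ).continuous.div (by fun_prop) fun x => ?_
  have hu : 0 < α * x ^ 2 + 1 := by positivity
  have hQ : 0 < κ * x ^ 4 + x ^ 2 + 1 := by positivity
  positivity

theorem sqrt_pow_mul_sqrt_pow_le {α κ : ℝ} (hα : 0 ≤ α) (hκ : 0 < κ)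
    {x r : ℝ} (hr : 1 ≤ r) (hx : |x| ≤ r) :
    √(α * x ^ 2 + 1) ^ 3 * √(κ * x ^ 4 + x ^ 2 + 1) ^ 5 ≤
      (α + 1) ^ 3 * (κ + 2) ^ 5 * r ^ 13 := by
  have hx2 : x ^ 2 ≤ r ^ 2 := sq_le_sq' (by linarith [(abs_le.1 hx).1]) (abs_le.1 hx).2
  have hr2 : 1 ≤ r ^ 2 := one_le_pow₀ hr
  have hx4 : x ^ 4 ≤ r ^ 4 := by nlinarith [sq_nonneg x]
  have hr4 : r ^ 2 ≤ r ^ 4 := by nlinarith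
  have h1 : √(α * x ^ 2 + 1) ≤ (α + 1) * r := by
    refine Real.sqrt_le_iff.2 ⟨by positivity, ?_⟩
    calc α * x ^ 2 + 1 ≤ α * r ^ 2 + r ^ 2 := by gcongr
      _ = (α + 1) * 1 * r ^ 2 := by ring
      _ ≤ (α + 1) * (α + 1) * r ^ 2 := by gcongr; linarith
      _ = _ := by ring
  have h2 : √(κ * x ^ 4 + x ^ 2 + 1) ≤ (κ + 2) * r ^ 2 := by
    refine Real.sqrt_le_iff.2 ⟨by positivity, ?_⟩
    calc κ * x ^ 4 + x ^ 2 + 1 ≤ κ * r ^ 4 + r ^ 4 + r ^ 4 := by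
          gcongr <;> linarith
      _ = (κ + 2) * 1 * r ^ 4 := by ring
      _ ≤ (κ + 2) * (κ + 2) * r ^ 4 := by gcongr; linarith
      _ = _ := by ring
  calc _ ≤ ((α + 1) * r) ^ 3 * ((κ + 2) * r ^ 2) ^ 5 := by gcongr
    _ = _ := by ring

theorem exists_le_abs_gBqPhaseDeriv2 {α κ : ℝ} (hα : 0 ≤ α) (hκ : 0 < κ)
    {l l₀ : ℕ} (hl : (gBqNum α κ).natDegree = l)
    (hl0 : l ≠ 0) (hsum : l + l₀ = 13) :
    ∃ c > 0, ∃ S : Multiset ℝ, S.card = l ∧ ∀ x ε W : ℝ, 0 < ε → |x| ^ l₀ ≤ W → 1 ≤ W * ε ^ l →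
      (∀ s ∈ S, ε ≤ |x - s|) → c ≤ |gBqPhaseDeriv2 α κ x| * W := by
  obtain ⟨S, hcard, hS⟩ := (gBqNum α κ).exists_multiset_prod_abs_sub_le_abs_eval
  rw [hl] at hcard
  have hne : gBqNum α κ ≠ 0 := by
    rintro h
    rw [h, Polynomial.natDegree_zero] at hl
    exact hl0 hl.symm
  set L := |(gBqNum α κ).leadingCoeff| with hL
  have hL0 : 0 < L := abs_pos.2 (Polynomial.leadingCoeff_ne_zero.2 hne)
  set K := (α + 1) ^ 3 * (κ + 2) ^ 5 with hK
  have hK0 : 0 < K := by positivity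
  obtain ⟨R, hR1, hR⟩ : ∃ R : ℝ, 1 ≤ R ∧ ∀ s ∈ S, 2 * |s| ≤ R := by
    obtain ⟨B, hB⟩ := (S.toFinset.image fun s => 2 * |s|).bddAbove
    refine ⟨max 1 B, le_max_left _ _, fun s hs => le_max_of_le_right (hB ?_)⟩
    simp only [Finset.coe_image, Set.mem_image, Finset.mem_coe, Multiset.mem_toFinset]
    exact ⟨s, hs, rfl⟩
  have key : ∀ x r y : ℝ, 1 ≤ r → |x| ≤ r → 0 ≤ y → (∀ s ∈ S, y ≤ |x - s|) →
      L * y ^ l / (K * r ^ 13) ≤ |gBqPhaseDeriv2 α κ x| := by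
    intro x r y hr hx hy hys
    have hu : 0 < α * x ^ 2 + 1 := by positivity
    have hQ : 0 < κ * x ^ 4 + x ^ 2 + 1 := by positivity
    have hD : 0 < √(α * x ^ 2 + 1) ^ 3 * √(κ * x ^ 4 + x ^ 2 + 1) ^ 5 := by positivity
    rw [gBqPhaseDeriv2, abs_div, abs_of_pos hD]
    refine div_le_div₀ (abs_nonneg _) ((mul_le_mul_of_nonneg_left ?_ hL0.le).trans (hS x)) hD
      (sqrt_pow_mul_sqrt_pow_le hα hκ hr hx)
    exact hcard ▸ Multiset.pow_card_le_prod_map hy hys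
  refine ⟨min (L / (K * 2 ^ l)) (L / (K * R ^ 13)), by positivity, S, hcard,
    fun x ε W hε hW hWε hx => ?_⟩
  have hW0 : 0 ≤ W := le_trans (by positivity) hW
  rcases le_total R |x| with h | h
  · refine (min_le_left _ _).trans ?_
    have hx0 : 0 < |x| := by linarith
    have h1 := key x |x| (|x| / 2) (hR1.trans h) le_rfl (by positivity) fun s hs => by
      linarith [hR s hs, abs_sub_abs_le_abs_sub x s]
    calc L / (K * 2 ^ l) = L * (|x| / 2) ^ l / (K * |x| ^ 13) * |x| ^ l₀ := by
          rw [← hsum, pow_add, div_pow]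
          field_simp
      _ ≤ _ := by gcongr
  · refine (min_le_right _ _).trans ?_
    have h1 := key x R ε hR1 h hε.le hx
    calc L / (K * R ^ 13) = L / (K * R ^ 13) * 1 := (mul_one _).symm
      _ ≤ L / (K * R ^ 13) * (W * ε ^ l) := by gcongr
      _ = L * ε ^ l / (K * R ^ 13) * W := by ring
      _ ≤ _ := by gcongr

theorem exists_norm_integral_exp_gBqPhase_le {α κ : ℝ} (hα : 0 ≤ α) (hκ : 0 < κ)
    {l l₀ : ℕ} (hl : (gBqNum α κ).natDegree = l)
    (hl0 : l ≠ 0) (hsum : l + l₀ = 13) :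
    ∃ C > (0 : ℝ), ∀ ε N t M lam : ℝ, 0 < ε → 0 ≤ N → 0 < t → 0 < M → N ^ l₀ ≤ M ^ 2 →
      1 ≤ M ^ 2 * ε ^ l →
      ‖∫ ξ in (-N)..N, Complex.exp (Complex.I * t * (gBqPhase α κ lam ξ : ℂ))‖ ≤
        C * (M / √t + ε) := by
  obtain ⟨c, hc, S, hcard, hS⟩ := exists_le_abs_gBqPhaseDeriv2 hα hκ hl hl0 hsum
  refine ⟨2 ^ l * (10 / √c + 2), by positivity, fun ε N t M lam hε hN ht hM hNM hεM => ?_⟩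
  have hρ : 0 < t * c / M ^ 2 := by positivity
  have hbound := norm_integral_exp_le_of_abs_deriv2_ge_off_balls
    (fun x => (hasDerivAt_gBqPhase hα hκ lam x).const_mul t)
    (fun x => (hasDerivAt_gBqPhaseDeriv hα hκ lam x).const_mul t)
    ((continuous_gBqPhaseDeriv2 hα hκ).const_mul t) hε.le hρ S (neg_le_self hN)
    fun x hx hxS => by
      rw [abs_mul, abs_of_pos ht, div_le_iff₀ (by positivity), mul_assoc]
      exact mul_le_mul_of_nonneg_left (hS x ε (M ^ 2) hε
        ((pow_le_pow_left₀ (abs_nonneg x) (abs_le.2 hx) l₀).trans hNM) hεM hxS) ht.le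
  have hcongr : ∀ ξ : ℝ, Complex.I * t * (gBqPhase α κ lam ξ : ℂ) =
      Complex.I * ((t * gBqPhase α κ lam ξ : ℝ) : ℂ) := fun ξ => by push_cast; ring
  simp only [hcongr]
  refine hbound.trans ?_
  rw [hcard, Real.sqrt_div' _ (by positivity), Real.sqrt_sq hM.le, Real.sqrt_mul ht.le]
  have e : 10 / (√t * √c / M) = 10 / √c * (M / √t) := by
    field_simp
  rw [e]
  have h1 : 0 ≤ 10 / √c := by positivity
  have h2 : 0 ≤ M / √t := by positivity
  have h3 : (0 : ℝ) ≤ 2 ^ l := by positivity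
  nlinarith [mul_nonneg h3 (mul_nonneg h1 hε.le), mul_nonneg h3 h2]

theorem exists_norm_integral_exp_gBqPhase_le_rpow {α κ : ℝ} (hα : 0 ≤ α) (hκ : 0 < κ)
    {l l₀ : ℕ} (hl : (gBqNum α κ).natDegree = l) (hl0 : l ≠ 0) (hsum : l + l₀ = 13) :
    ∃ C > (0 : ℝ), ∀ ε N t lam : ℝ, 0 < ε → 0 < N → 0 < t →
      ‖∫ ξ in (-N)..N, Complex.exp (Complex.I * t * (gBqPhase α κ lam ξ : ℂ))‖ ≤
        C * (t ^ (-(1 / 2 : ℝ)) * max (N ^ ((l₀ : ℝ) / 2)) (ε ^ (-((l : ℝ) / 2))) + ε) := by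
  obtain ⟨C, hC, h⟩ := exists_norm_integral_exp_gBqPhase_le hα hκ hl hl0 hsum
  refine ⟨C, hC, fun ε N t lam hε hN ht => ?_⟩
  set M := max (N ^ ((l₀ : ℝ) / 2)) (ε ^ (-((l : ℝ) / 2))) with hM
  have hN' : (N ^ ((l₀ : ℝ) / 2)) ^ 2 = N ^ l₀ := by
    rw [← Real.rpow_natCast, ← Real.rpow_mul hN.le, ← Real.rpow_natCast]
    congr 1
    push_cast
    ring
  have hε' : (ε ^ (-((l : ℝ) / 2))) ^ 2 * ε ^ l = 1 := by
    rw [← Real.rpow_natCast, ← Real.rpow_mul hε.le, ← Real.rpow_natCast, ← Real.rpow_add hε]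
    convert! Real.rpow_zero ε using 2
    push_cast
    ring
  have h1 : N ^ ((l₀ : ℝ) / 2) ≤ M := le_max_left _ _
  have h2 : ε ^ (-((l : ℝ) / 2)) ≤ M := le_max_right _ _
  have h3 : 0 < N ^ ((l₀ : ℝ) / 2) := by positivity
  have h4 : 0 < ε ^ (-((l : ℝ) / 2)) := by positivity
  have := h ε N t M lam hε hN.le ht (h3.trans_le h1) (hN' ▸ by gcongr) (by rw [← hε']; gcongr)
  rwa [div_eq_inv_mul, Real.sqrt_eq_rpow, ← Real.rpow_neg ht.le] at this

theorem oscillatory_integral_estimate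
    (α κ : ℝ) (hα : 0 ≤ α) (hκ : 0 < κ)
    (ℓ ℓ₀ : ℝ)
    (hcase1 : (κ = α ∨ α = 0) → ℓ = 7 ∧ ℓ₀ = 6)
    (hcase2 : (κ ≠ α ∧ α ≠ 0) → ℓ = 9 ∧ ℓ₀ = 4) :
    ∃ ε₀ > (0 : ℝ), ∃ N₀ > (0 : ℝ), ∃ C > (0 : ℝ),
      ∀ ε : ℝ, 0 < ε → ε < ε₀ → ∀ N : ℝ, N₀ ≤ N → ∀ t : ℝ, 0 < t → ∀ lam : ℝ,
        ‖∫ ξ in (-N)..N, Complex.exp (Complex.I * t * (gBqPhase α κ lam ξ : ℂ))‖ ≤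
          C * (t ^ (-(1 / 2 : ℝ)) * max (N ^ (ℓ₀ / 2)) (ε ^ (-(ℓ / 2))) + ε) := by
  obtain ⟨l, l₀, hl, hl0, hsum, rfl, rfl⟩ : ∃ l l₀ : ℕ, (gBqNum α κ).natDegree = l ∧ l ≠ 0 ∧
      l + l₀ = 13 ∧ (l : ℝ) = ℓ ∧ (l₀ : ℝ) = ℓ₀ := by
    by_cases h : κ = α ∨ α = 0
    · obtain ⟨rfl, rfl⟩ := hcase1 h
      exact ⟨7, 6, natDegree_gBqNum_of_eq hκ.ne' h, by norm_num⟩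
    · rw [not_or] at h
      obtain ⟨rfl, rfl⟩ := hcase2 h
      exact ⟨9, 4, natDegree_gBqNum_of_ne hκ.ne' h.2 h.1, by norm_num⟩
  obtain ⟨C, hC, h⟩ := exists_norm_integral_exp_gBqPhase_le_rpow hα hκ hl hl0 hsum
  exact ⟨1, one_pos, 1, one_pos, C, hC, fun ε hε _ N hN t ht lam =>
    h ε N t lam hε (by linarith) ht⟩
end

section
/- Let $\alpha > 0$, $\kappa > 0$, $\beta < 0$, $c \in \mathbb{R}$ with $c^2 \ge \max\{\alpha, 1\}$, and let $p \ge 2$ be an even integer. If $Q$ is a real-valued Schwartz function on $\mathbb{R}$ satisfying $\kappa c^2 Q'''' + (\alpha - c^2) Q'' + (c^2 - 1) Q = \beta Q^{p+1}$ on all of $\mathbb{R}$, then $Q \equiv 0$. -/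
open MeasureTheory in
/-- A nonpositive Schwartz function whose integral is nonnegative vanishes identically. -/
theorem SchwartzMap.eq_zero_of_nonpos_of_integral_nonneg (f : SchwartzMap ℝ ℝ)
    (hf : ∀ x, f x ≤ 0) (hint : 0 ≤ ∫ x, f x) (x : ℝ) : f x = 0 := by
  have hzero : ∫ x, -f x = 0 := by
    refine le_antisymm ?_ (integral_nonneg fun x => neg_nonneg.2 (hf x))
    rw [integral_neg]
    exact neg_nonpos.2 hint
  rw [integral_eq_zero_iff_of_nonneg (fun x => neg_nonneg.2 (hf x)) f.integrable.neg] at hzero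
  have hneg := (Continuous.ae_eq_iff_eq volume f.continuous.neg continuous_zero).1 hzero
  simpa using congrFun hneg x

/-- The product of two real Schwartz functions on the line. -/
noncomputable def SchwartzMap.mulReal (f g : SchwartzMap ℝ ℝ) : SchwartzMap ℝ ℝ :=
  SchwartzMap.pairing (ContinuousLinearMap.mul ℝ ℝ) f g

@[simp]
theorem SchwartzMap.mulReal_apply (f g : SchwartzMap ℝ ℝ) (x : ℝ) :
    f.mulReal g x = f x * g x := rfl

/-- Integration by parts: the derivative can be moved across a product of Schwartz functions. -/
theorem SchwartzMap.integral_mulReal_derivCLM (f g : SchwartzMap ℝ ℝ) :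
    ∫ x, f.mulReal (derivCLM ℝ ℝ g) x = -∫ x, (derivCLM ℝ ℝ f).mulReal g x :=
  SchwartzMap.integral_mul_deriv_eq_neg_deriv_mul f g

theorem SchwartzMap.integral_mulReal_self_nonneg (f : SchwartzMap ℝ ℝ) :
    0 ≤ ∫ x, f.mulReal f x :=
  MeasureTheory.integral_nonneg fun x => mul_self_nonneg (f x)

theorem SchwartzMap.iteratedDeriv_eq_iterate_derivCLM (f : SchwartzMap ℝ ℝ) (n : ℕ) :
    iteratedDeriv n f = ((derivCLM ℝ ℝ)^[n] f : SchwartzMap ℝ ℝ) := by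
  induction n with
  | zero => simp
  | succ n ih =>
    rw [iteratedDeriv_succ, ih, Function.iterate_succ_apply']
    rfl

/-- Non-existence of solitary waves: case `c² ≥ max{α,1}`, `β < 0`, `p` even. -/
theorem no_solitary_wave_case_i
    (α κ β c : ℝ) (p : ℕ)
    (hα : 0 < α) (hκ : 0 < κ) (hβ : β < 0)
    (hc : max α 1 ≤ c ^ 2) (hp : 2 ≤ p) (hpe : Even p)
    (Q : SchwartzMap ℝ ℝ)
    (hQ : ∀ x : ℝ,
      κ * c ^ 2 * iteratedDeriv 4 (⇑Q) x + (α - c ^ 2) * iteratedDeriv 2 (⇑Q) x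
        + (c ^ 2 - 1) * Q x = β * (Q x) ^ (p + 1)) :
    ∀ x : ℝ, Q x = 0 := by
  obtain ⟨hcα, hc1⟩ := max_le_iff.1 hc
  simp only [SchwartzMap.iteratedDeriv_eq_iterate_derivCLM, Function.iterate_succ_apply',
    Function.iterate_zero_apply] at hQ
  set D := SchwartzMap.derivCLM ℝ ℝ
  set F : SchwartzMap ℝ ℝ :=
    (κ * c ^ 2) • Q.mulReal (D (D (D (D Q)))) + (α - c ^ 2) • Q.mulReal (D (D Q)) with hF
  have hFx (x : ℝ) : F x = β * Q x ^ (p + 2) - (c ^ 2 - 1) * Q x ^ 2 := by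
    simp only [hF, add_apply, smul_apply, SchwartzMap.mulReal_apply,
      smul_eq_mul]
    linear_combination Q x * hQ x
  have hpow (x : ℝ) : 0 ≤ Q x ^ (p + 2) := (hpe.add even_two).pow_nonneg _
  have hFnonpos (x : ℝ) : F x ≤ 0 := by
    rw [hFx]
    nlinarith [mul_nonneg (neg_nonneg.2 hβ.le) (hpow x),
      mul_nonneg (sub_nonneg.2 hc1) (sq_nonneg (Q x))]
  have hFint : 0 ≤ ∫ x, F x := by
    have hsplit : ∫ x, F x = κ * c ^ 2 * (∫ x, Q.mulReal (D (D (D (D Q)))) x)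
        + (α - c ^ 2) * ∫ x, Q.mulReal (D (D Q)) x := by
      simp only [hF, add_apply, smul_apply, smul_eq_mul]
      rw [MeasureTheory.integral_add ((SchwartzMap.integrable _).const_mul _)
        ((SchwartzMap.integrable _).const_mul _), MeasureTheory.integral_const_mul,
        MeasureTheory.integral_const_mul]
    rw [hsplit, SchwartzMap.integral_mulReal_derivCLM Q (D (D (D Q))),
      SchwartzMap.integral_mulReal_derivCLM (D Q) (D (D Q)),
      SchwartzMap.integral_mulReal_derivCLM Q (D Q), neg_neg]
    have h₂ := mul_nonneg (mul_nonneg hκ.le (sq_nonneg c)) (D (D Q)).integral_mulReal_self_nonneg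
    have h₁ := mul_nonneg (sub_nonneg.2 hcα) (D Q).integral_mulReal_self_nonneg
    linarith
  intro x
  have hFzero := F.eq_zero_of_nonpos_of_integral_nonneg hFnonpos hFint x
  rw [hFx] at hFzero
  refine eq_zero_of_pow_eq_zero (n := p + 2) ?_
  nlinarith [hpow x, mul_nonneg (sub_nonneg.2 hc1) (sq_nonneg (Q x))]
end

section
/- Let $\alpha > 0$, $\kappa > 0$, $\beta > 0$, $c \in \mathbb{R}$ with $c^2 \le \min\{\alpha, 1\}$, and let $p \ge 2$ be an even integer. If $Q$ is a real-valued Schwartz function on $\mathbb{R}$ satisfying $\kappa c^2 Q'''' + (\alpha - c^2) Q'' + (c^2 - 1) Q = \beta Q^{p+1}$ on all of $\mathbb{R}$, then $Q \equiv 0$. -/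
open Filter Topology

/-- A monotone function on the line vanishing at both ends is zero. -/
theorem Monotone.eq_zero_of_tendsto_cocompact {G : ℝ → ℝ} (hG : Monotone G)
    (hlim : Tendsto G (cocompact ℝ) (𝓝 0)) : G = fun _ => 0 :=
  funext fun x => le_antisymm (hG.ge_of_tendsto (hlim.mono_left atTop_le_cocompact) x)
    (hG.le_of_tendsto (hlim.mono_left atBot_le_cocompact) x)

/-- A differentiable function on the line with nonnegative derivative, vanishing at both ends,
has zero derivative. -/
theorem hasDerivAt_eq_zero_of_nonneg_of_tendsto {G g : ℝ → ℝ}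
    (hG : ∀ x, HasDerivAt G (g x) x) (hg : ∀ x, 0 ≤ g x)
    (hlim : Tendsto G (cocompact ℝ) (𝓝 0)) (x : ℝ) : g x = 0 := by
  have h := hG x
  rw [(monotone_of_hasDerivAt_nonneg hG hg).eq_zero_of_tendsto_cocompact hlim] at h
  exact h.unique (hasDerivAt_const x 0)

/-- A differentiable function on the line with zero derivative, vanishing at infinity, is zero. -/
theorem eq_zero_of_hasDerivAt_zero_of_tendsto {G : ℝ → ℝ}
    (hG : ∀ x, HasDerivAt G 0 x) (hlim : Tendsto G (cocompact ℝ) (𝓝 0)) (x : ℝ) : G x = 0 :=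
  congrFun ((monotone_of_hasDerivAt_nonneg hG fun _ => le_rfl).eq_zero_of_tendsto_cocompact hlim) x

theorem SchwartzMap.exists_hasDerivAt (f : SchwartzMap ℝ ℝ) :
    ∃ g : SchwartzMap ℝ ℝ, ⇑g = deriv f ∧ ∀ x, HasDerivAt f (g x) x :=
  ⟨SchwartzMap.derivCLM ℝ ℝ f, funext fun x => SchwartzMap.derivCLM_apply ℝ f x,
    fun x => by
      rw [SchwartzMap.derivCLM_apply]
      exact f.differentiableAt.hasDerivAt⟩

theorem SchwartzMap.tendsto_cocompact_zero (f : SchwartzMap ℝ ℝ) :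
    Tendsto f (cocompact ℝ) (𝓝 0) :=
  zero_at_infty f

/-- Non-existence of solitary waves: case `c² ≤ min{α,1}`, `β > 0`, `p` even. -/
theorem no_solitary_wave_case_ii
    (α κ β c : ℝ) (p : ℕ)
    (hα : 0 < α) (hκ : 0 < κ) (hβ : 0 < β)
    (hc : c ^ 2 ≤ min α 1) (hp : 2 ≤ p) (hpe : Even p)
    (Q : SchwartzMap ℝ ℝ)
    (hQ : ∀ x : ℝ,
      κ * c ^ 2 * iteratedDeriv 4 (⇑Q) x + (α - c ^ 2) * iteratedDeriv 2 (⇑Q) x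
        + (c ^ 2 - 1) * Q x = β * (Q x) ^ (p + 1)) :
    ∀ x : ℝ, Q x = 0 := by
  obtain ⟨Q₁, e₁, h₁⟩ := Q.exists_hasDerivAt
  obtain ⟨Q₂, e₂, h₂⟩ := Q₁.exists_hasDerivAt
  obtain ⟨Q₃, e₃, h₃⟩ := Q₂.exists_hasDerivAt
  obtain ⟨Q₄, e₄, h₄⟩ := Q₃.exists_hasDerivAt
  have hode : ∀ x, κ * c ^ 2 * Q₄ x + (α - c ^ 2) * Q₂ x + (c ^ 2 - 1) * Q x
      = β * Q x ^ (p + 1) := by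
    intro x
    have := hQ x
    simpa only [iteratedDeriv_succ, iteratedDeriv_zero, ← e₁, ← e₂, ← e₃, ← e₄] using this
  have ha : 0 ≤ α - c ^ 2 := sub_nonneg.2 (hc.trans (min_le_left _ _))
  have hb : 0 ≤ 1 - c ^ 2 := sub_nonneg.2 (hc.trans (min_le_right _ _))
  have hpp : (0 : ℝ) < p + 2 := by positivity
  have t₀ := Q.tendsto_cocompact_zero
  have t₁ := Q₁.tendsto_cocompact_zero
  have t₂ := Q₂.tendsto_cocompact_zero
  have t₃ := Q₃.tendsto_cocompact_zero
  -- the first integral of the profile equation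
  have henergy : ∀ x, κ * c ^ 2 * (Q₁ x * Q₃ x - Q₂ x ^ 2 / 2) + (α - c ^ 2) * (Q₁ x ^ 2 / 2)
      + (c ^ 2 - 1) * (Q x ^ 2 / 2) - β / (p + 2) * Q x ^ (p + 2) = 0 := by
    refine eq_zero_of_hasDerivAt_zero_of_tendsto (fun x => ?_) ?_
    · have h := ((((((h₂ x).mul (h₄ x)).sub (((h₃ x).pow 2).div_const 2)).const_mul
        (κ * c ^ 2)).add ((((h₂ x).pow 2).div_const 2).const_mul (α - c ^ 2))).add
        ((((h₁ x).pow 2).div_const 2).const_mul (c ^ 2 - 1))).sub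
        (((h₁ x).pow (p + 2)).const_mul (β / (p + 2)))
      refine h.congr_deriv ?_
      push_cast
      field_simp
      linear_combination Q₁ x * hode x
    · simpa using ((((((t₁.mul t₃).sub ((t₂.pow 2).div_const 2)).const_mul
        (κ * c ^ 2)).add (((t₁.pow 2).div_const 2).const_mul (α - c ^ 2))).add
        (((t₀.pow 2).div_const 2).const_mul (c ^ 2 - 1))).sub
        ((t₀.pow (p + 2)).const_mul (β / (p + 2))))
  have heven : Even (p + 2) := hpe.add even_two
  have hvirial := hasDerivAt_eq_zero_of_nonneg_of_tendsto
    (G := fun x => κ * c ^ 2 * (Q x * Q₃ x - Q₁ x * Q₂ x / 3) + (α - c ^ 2) * (Q x * Q₁ x))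
    (g := fun x => 4 / 3 * (1 - c ^ 2) * Q x ^ 2 + 2 / 3 * (α - c ^ 2) * Q₁ x ^ 2
      + (β + 2 / 3 * (β / (p + 2))) * Q x ^ (p + 2))
    (fun x => by
      have h := ((((h₁ x).mul (h₄ x)).sub (((h₂ x).mul (h₃ x)).div_const 3)).const_mul
        (κ * c ^ 2)).add (((h₁ x).mul (h₂ x)).const_mul (α - c ^ 2))
      refine h.congr_deriv ?_
      linear_combination Q x * hode x + 2 / 3 * henergy x)
    (fun x => by
      have := heven.pow_nonneg (Q x)
      positivity)
    (by
      simpa using (((t₀.mul t₃).sub ((t₁.mul t₂).div_const 3)).const_mul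
        (κ * c ^ 2)).add ((t₀.mul t₁).const_mul (α - c ^ 2)))
  intro x
  have hpow := heven.pow_nonneg (Q x)
  have hcoef : 0 < β + 2 / 3 * (β / (p + 2)) := by positivity
  have hu : 0 ≤ 4 / 3 * (1 - c ^ 2) * Q x ^ 2 := by positivity
  have hv : 0 ≤ 2 / 3 * (α - c ^ 2) * Q₁ x ^ 2 := by positivity
  have hw := mul_nonneg hcoef.le hpow
  have hzero : (β + 2 / 3 * (β / (p + 2))) * Q x ^ (p + 2) = 0 := by
    linarith [hvirial x]
  exact eq_zero_of_pow_eq_zero ((mul_eq_zero.1 hzero).resolve_left hcoef.ne')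
end

section
/- Let $\alpha > 0$, $\kappa > 0$, $\beta \in \mathbb{R}$, $c \in \mathbb{R}$ with $\alpha \le c^2 < 1$, and let $p \ge 1$ be an integer. If $Q$ is a real-valued Schwartz function on $\mathbb{R}$ satisfying $\kappa c^2 Q'''' + (\alpha - c^2) Q'' + (c^2 - 1) Q = \beta Q^{p+1}$ on all of $\mathbb{R}$, then $Q \equiv 0$. -/
open Filter Topology

lemma SchwartzMap.hasDerivAt_derivCLM (f : SchwartzMap ℝ ℝ) (x : ℝ) :
    HasDerivAt f (SchwartzMap.derivCLM ℝ ℝ f x) x := by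
  rw [SchwartzMap.derivCLM_apply]
  exact f.differentiableAt.hasDerivAt

/-- An antitone function on `ℝ` with the same limit at `±∞` is constant. -/
lemma Antitone.eq_of_tendsto_atBot_atTop {F : ℝ → ℝ} (hF : Antitone F) {l : ℝ}
    (hbot : Tendsto F atBot (𝓝 l)) (htop : Tendsto F atTop (𝓝 l)) (x : ℝ) : F x = l :=
  le_antisymm (hF.ge_of_tendsto hbot x) (hF.le_of_tendsto htop x)

/-- A Schwartz solution of `a Q₄ - b Q₂ - d Q = β Q ^ (p + 1)`, where `Qᵢ` is the `i`-th
derivative of `Q`, `a, b ≥ 0` and `d > 0`, vanishes: the first integral of the equation turns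
the equation multiplied by `Q` into the monotonicity of a flux that vanishes at infinity. -/
lemma SchwartzMap.eq_zero_of_fourth_order_eq {a b d β : ℝ} {p : ℕ} (ha : 0 ≤ a) (hb : 0 ≤ b)
    (hd : 0 < d) (hp : 1 ≤ p) {Q Q₁ Q₂ Q₃ Q₄ : SchwartzMap ℝ ℝ}
    (h₁ : ∀ x, HasDerivAt Q (Q₁ x) x) (h₂ : ∀ x, HasDerivAt Q₁ (Q₂ x) x)
    (h₃ : ∀ x, HasDerivAt Q₂ (Q₃ x) x) (h₄ : ∀ x, HasDerivAt Q₃ (Q₄ x) x)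
    (hQ : ∀ x, a * Q₄ x - b * Q₂ x - d * Q x = β * Q x ^ (p + 1)) (x : ℝ) : Q x = 0 := by
  have htop (f : SchwartzMap ℝ ℝ) : Tendsto f atTop (𝓝 0) :=
    (zero_at_infty f).mono_left atTop_le_cocompact
  have hbot (f : SchwartzMap ℝ ℝ) : Tendsto f atBot (𝓝 0) :=
    (zero_at_infty f).mono_left atBot_le_cocompact
  have hp0 : (0 : ℝ) < p := by exact_mod_cast hp
  let E : ℝ → ℝ := fun y ↦ (p + 2) * (a * (Q₃ y * Q₁ y - Q₂ y ^ 2 / 2) - b * Q₁ y ^ 2 / 2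
    - d * Q y ^ 2 / 2) - β * Q y ^ (p + 2)
  have hE' (y : ℝ) : HasDerivAt E 0 y := by
    have h := (((((((h₄ y).mul (h₂ y)).sub (((h₃ y).pow 2).div_const 2)).const_mul a).sub
      ((((h₂ y).pow 2).const_mul b).div_const 2)).sub
      ((((h₁ y).pow 2).const_mul d).div_const 2)).const_mul ((p : ℝ) + 2)).sub
      (((h₁ y).pow (p + 2)).const_mul β)
    refine h.congr_deriv ?_
    push_cast
    linear_combination ((p : ℝ) + 2) * Q₁ y * hQ y
  have hE (y : ℝ) : E y = 0 := by
    have hconst (z : ℝ) : E z = E y :=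
      is_const_of_deriv_eq_zero (fun w ↦ (hE' w).differentiableAt) (fun w ↦ (hE' w).deriv) z y
    have hlim : Tendsto E atTop (𝓝 0) := by
      have h := (((((((htop Q₃).mul (htop Q₁)).sub (((htop Q₂).pow 2).div_const 2)).const_mul
        a).sub ((((htop Q₁).pow 2).const_mul b).div_const 2)).sub
        ((((htop Q).pow 2).const_mul d).div_const 2)).const_mul ((p : ℝ) + 2)).sub
        (((htop Q).pow (p + 2)).const_mul β)
      simpa [E] using h
    exact tendsto_nhds_unique (tendsto_const_nhds.congr fun z ↦ (hconst z).symm) hlim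
  let F : ℝ → ℝ := fun y ↦ a * (Q₃ y * Q y - (p + 3) * (Q₂ y * Q₁ y)) - b * (Q₁ y * Q y)
  let D : ℝ → ℝ := fun y ↦ a * (3 * p + 8) / 2 * Q₂ y ^ 2 + b * (p + 4) / 2 * Q₁ y ^ 2
    + d * p / 2 * Q y ^ 2
  have hF' (y : ℝ) : HasDerivAt F (-D y) y := by
    have h := ((((h₄ y).mul (h₁ y)).sub (((h₃ y).mul (h₂ y)).const_mul ((p : ℝ) + 3))).const_mul
      a).sub (((h₂ y).mul (h₁ y)).const_mul b)
    refine h.congr_deriv ?_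
    have hEy := hE y
    simp only [E, D] at hEy ⊢
    linear_combination Q y * hQ y - hEy
  have hF : Antitone F := by
    refine antitone_of_deriv_nonpos (fun y ↦ (hF' y).differentiableAt) fun y ↦ ?_
    rw [(hF' y).deriv, neg_nonpos]
    positivity
  have hlim {l : Filter ℝ} (hl : ∀ f : SchwartzMap ℝ ℝ, Tendsto f l (𝓝 0)) :
      Tendsto F l (𝓝 0) := by
    have h := ((((hl Q₃).mul (hl Q)).sub (((hl Q₂).mul (hl Q₁)).const_mul ((p : ℝ) + 3))).const_mul
      a).sub (((hl Q₁).mul (hl Q)).const_mul b)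
    simpa [F] using h
  have hF0 : F = fun _ ↦ 0 :=
    funext (hF.eq_of_tendsto_atBot_atTop (hlim hbot) (hlim htop))
  have hD : D x = 0 := by
    have h := (hF' x).deriv
    rw [hF0, deriv_const] at h
    linarith
  have hsq : d * p / 2 * Q x ^ 2 = 0 := by
    have hQ₂ : 0 ≤ a * (3 * p + 8) / 2 * Q₂ x ^ 2 := by positivity
    have hQ₁ : 0 ≤ b * (p + 4) / 2 * Q₁ x ^ 2 := by positivity
    have hQ₀ : 0 ≤ d * p / 2 * Q x ^ 2 := by positivity
    simp only [D] at hD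
    linarith
  have hdp : d * p / 2 ≠ 0 := by positivity
  simpa [hdp] using (mul_eq_zero.mp hsq).resolve_left hdp

/-- Non-existence of solitary waves: case `α ≤ c² < 1`, any `p ≥ 1`. -/
theorem no_solitary_wave_case_iii
    (α κ β c : ℝ) (p : ℕ)
    (hα : 0 < α) (hκ : 0 < κ)
    (hc1 : α ≤ c ^ 2) (hc2 : c ^ 2 < 1) (hp : 1 ≤ p)
    (Q : SchwartzMap ℝ ℝ)
    (hQ : ∀ x : ℝ,
      κ * c ^ 2 * iteratedDeriv 4 (⇑Q) x + (α - c ^ 2) * iteratedDeriv 2 (⇑Q) x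
        + (c ^ 2 - 1) * Q x = β * (Q x) ^ (p + 1)) :
    ∀ x : ℝ, Q x = 0 := by
  let D := SchwartzMap.derivCLM ℝ ℝ
  have hD (f : SchwartzMap ℝ ℝ) : deriv f = D f :=
    funext fun x ↦ (SchwartzMap.derivCLM_apply ℝ f x).symm
  have hQ₂ : iteratedDeriv 2 Q = D (D Q) := by
    simp only [iteratedDeriv_succ', iteratedDeriv_zero, hD]
  have hQ₄ : iteratedDeriv 4 Q = D (D (D (D Q))) := by
    simp only [iteratedDeriv_succ', iteratedDeriv_zero, hD]
  refine SchwartzMap.eq_zero_of_fourth_order_eq (a := κ * c ^ 2) (b := c ^ 2 - α)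
    (d := 1 - c ^ 2) (β := β) (by positivity) (sub_nonneg.mpr hc1) (sub_pos.mpr hc2) hp
    Q.hasDerivAt_derivCLM (D Q).hasDerivAt_derivCLM (D (D Q)).hasDerivAt_derivCLM
    (D (D (D Q))).hasDerivAt_derivCLM fun x ↦ ?_
  have h := hQ x
  rw [hQ₂, hQ₄] at h
  linear_combination h
end

section
/- Let $\alpha > 0$, $\kappa > 0$, $\beta \in \mathbb{R}$, $c \in \mathbb{R}$, and let $p \ge 1$ be an integer. If $Q$ is a real-valued Schwartz function on $\mathbb{R}$ satisfying $\kappa c^2 Q'''' + (\alpha - c^2) Q'' + (c^2 - 1) Q = \beta Q^{p+1}$ on all of $\mathbb{R}$, then the Pohozaev-type identity $\frac{3\kappa c^2}{2} \int_{\mathbb{R}} (Q'')^2\, dx + \frac{c^2 - \alpha}{2} \int_{\mathbb{R}} (Q')^2\, dx - \frac{c^2 - 1}{2} \int_{\mathbb{R}} Q^2\, dx = -\frac{\beta}{p+2} \int_{\mathbb{R}} Q^{p+2}\, dx$ holds. -/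
open MeasureTheory SchwartzMap

theorem SchwartzMap.integrable_mul_pow (f : SchwartzMap ℝ ℝ) {g : ℝ → ℝ}
    (hg : Integrable g) (n : ℕ) : Integrable fun x => g x * f x ^ n := by
  have hbdd : ∀ x, ‖f x‖ ≤ ‖f.toBoundedContinuousFunction‖ :=
    f.toBoundedContinuousFunction.norm_coe_le_norm
  refine hg.mul_bdd (c := ‖f.toBoundedContinuousFunction‖ ^ n)
    (f.continuous.pow n).aestronglyMeasurable (.of_forall fun x => ?_)
  rw [norm_pow]
  exact pow_le_pow_left₀ (norm_nonneg _) (hbdd x) n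

theorem SchwartzMap.integrable_id_mul (f : SchwartzMap ℝ ℝ) :
    Integrable fun x => x * f x := by
  refine (f.integrable_pow_mul volume 1).mono'
    (continuous_id.mul f.continuous).aestronglyMeasurable (.of_forall fun x => ?_)
  simp

theorem SchwartzMap.integrable_mul (f g : SchwartzMap ℝ ℝ) :
    Integrable fun x => f x * g x := by
  simpa using g.integrable_mul_pow f.integrable 1

theorem SchwartzMap.integrable_id_mul_mul (f g : SchwartzMap ℝ ℝ) :
    Integrable fun x => x * f x * g x := by
  simpa using g.integrable_mul_pow f.integrable_id_mul 1

theorem SchwartzMap.iteratedDeriv_derivCLM (f : SchwartzMap ℝ ℝ) (n : ℕ) :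
    iteratedDeriv n (derivCLM ℝ ℝ f) = iteratedDeriv (n + 1) f := by
  rw [iteratedDeriv_succ']
  rfl

/-- Pohozaev-type identity obtained by multiplying the solitary-wave ODE by
`x Q'(x)` and integrating over `ℝ`. -/
theorem solitary_wave_pohozaev_identity
    (α κ β c : ℝ) (p : ℕ)
    (hα : 0 < α) (hκ : 0 < κ) (hp : 1 ≤ p)
    (Q : SchwartzMap ℝ ℝ)
    (hQ : ∀ x : ℝ,
      κ * c ^ 2 * iteratedDeriv 4 (⇑Q) x + (α - c ^ 2) * iteratedDeriv 2 (⇑Q) x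
        + (c ^ 2 - 1) * Q x = β * (Q x) ^ (p + 1)) :
    (3 * κ * c ^ 2 / 2) * (∫ x : ℝ, (iteratedDeriv 2 (⇑Q) x) ^ 2)
      + ((c ^ 2 - α) / 2) * (∫ x : ℝ, (deriv (⇑Q) x) ^ 2)
      - ((c ^ 2 - 1) / 2) * (∫ x : ℝ, (Q x) ^ 2)
      = -(β / ((p : ℝ) + 2)) * ∫ x : ℝ, (Q x) ^ (p + 2) := by
  set Q₁ := derivCLM ℝ ℝ Q with hQ₁
  set Q₂ := derivCLM ℝ ℝ Q₁ with hQ₂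
  set Q₃ := derivCLM ℝ ℝ Q₂ with hQ₃
  set Q₄ := derivCLM ℝ ℝ Q₃ with hQ₄
  have e1 : deriv Q = Q₁ := rfl
  have e2 : iteratedDeriv 2 Q = Q₂ := by
    rw [← iteratedDeriv_derivCLM, iteratedDeriv_one]
    rfl
  have e4 : iteratedDeriv 4 Q = Q₄ := by
    simp only [← iteratedDeriv_derivCLM, ← hQ₁, ← hQ₂, ← hQ₃, ← hQ₄, iteratedDeriv_zero]
  rw [e1, e2]
  rw [e2, e4] at hQ
  have hp2 : (p : ℝ) + 2 ≠ 0 := by positivity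
  have i2 : Integrable fun x => Q₂ x ^ 2 := by simpa only [sq] using Q₂.integrable_mul Q₂
  have i1 : Integrable fun x => Q₁ x ^ 2 := by simpa only [sq] using Q₁.integrable_mul Q₁
  have i0 : Integrable fun x => Q x ^ 2 := by simpa only [sq] using Q.integrable_mul Q
  have ip : Integrable fun x => Q x ^ (p + 2) := by
    refine (Q.integrable_mul_pow Q.integrable (p + 1)).congr (.of_forall fun x => ?_)
    ring
  have jp : Integrable fun x => x * Q x ^ (p + 2) := by
    refine (Q.integrable_mul_pow Q.integrable_id_mul (p + 1)).congr (.of_forall fun x => ?_)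
    ring
  set F : ℝ → ℝ := fun x =>
    κ * c ^ 2 * (x * Q₁ x * Q₃ x - Q₁ x * Q₂ x - (1 / 2) * (x * Q₂ x * Q₂ x))
      + (α - c ^ 2) / 2 * (x * Q₁ x * Q₁ x) + (c ^ 2 - 1) / 2 * (x * Q x * Q x)
      - β / (p + 2) * (x * Q x ^ (p + 2))
  set G : ℝ → ℝ := fun x =>
    - (3 * κ * c ^ 2 / 2) * Q₂ x ^ 2 - (c ^ 2 - α) / 2 * Q₁ x ^ 2
      + (c ^ 2 - 1) / 2 * Q x ^ 2 - β / (p + 2) * Q x ^ (p + 2) with hG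
  have hFG : ∀ x, HasDerivAt F (G x) x := by
    intro x
    have d0 : HasDerivAt Q (Q₁ x) x := Q.hasDerivAt x
    have d1 : HasDerivAt Q₁ (Q₂ x) x := Q₁.hasDerivAt x
    have d2 : HasDerivAt Q₂ (Q₃ x) x := Q₂.hasDerivAt x
    have d3 : HasDerivAt Q₃ (Q₄ x) x := Q₃.hasDerivAt x
    have dx := hasDerivAt_id' x
    have d := ((((((dx.mul d1).mul d3).sub (d1.mul d2)).sub
      (((dx.mul d2).mul d2).const_mul (1 / 2))).const_mul (κ * c ^ 2)).add
      (((dx.mul d1).mul d1).const_mul ((α - c ^ 2) / 2))).add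
      (((dx.mul d0).mul d0).const_mul ((c ^ 2 - 1) / 2)) |>.sub
      ((dx.mul (d0.pow (p + 2))).const_mul (β / (p + 2)))
    refine d.congr_deriv ?_
    simp only [hG, Pi.mul_apply, Pi.pow_apply, Nat.cast_add, Nat.cast_ofNat,
      show p + 2 - 1 = p + 1 from rfl]
    field_simp
    linear_combination (2 * (p + 2) * x * Q₁ x) * hQ x
  have iF : Integrable F :=
    ((((((Q₁.integrable_id_mul_mul Q₃).sub (Q₁.integrable_mul Q₂)).sub
      ((Q₂.integrable_id_mul_mul Q₂).const_mul _)).const_mul _).add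
      ((Q₁.integrable_id_mul_mul Q₁).const_mul _)).add
      ((Q.integrable_id_mul_mul Q).const_mul _)).sub (jp.const_mul _)
  have k2 := i2.const_mul (-(3 * κ * c ^ 2 / 2))
  have k1 := i1.const_mul ((c ^ 2 - α) / 2)
  have k0 := i0.const_mul ((c ^ 2 - 1) / 2)
  have kp := ip.const_mul (β / (p + 2))
  have hzero := integral_eq_zero_of_hasDerivAt_of_integrable hFG
    (((k2.sub k1).add k0).sub kp) iF
  simp only [hG] at hzero
  rw [integral_sub (hg := kp), integral_add (hg := k0), integral_sub k2 k1] at hzero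
  rotate_left
  · exact k2.sub k1
  · exact (k2.sub k1).add k0
  simp only [integral_const_mul] at hzero
  linear_combination -hzero
end

section
/- Let $\alpha > 0$, $\kappa > 0$, $\beta \in \mathbb{R}$, $c \in \mathbb{R}$, and let $p \ge 1$ be an integer. If $Q$ is a real-valued Schwartz function on $\mathbb{R}$ satisfying $\kappa c^2 Q'''' + (\alpha - c^2) Q'' + (c^2 - 1) Q = \beta Q^{p+1}$ on all of $\mathbb{R}$, then $\kappa c^2 \left( \frac{3p}{2} + 4 \right) \int_{\mathbb{R}} (Q'')^2\, dx + (c^2 - \alpha) \frac{p+4}{2} \int_{\mathbb{R}} (Q')^2\, dx = (c^2 - 1) \frac{p}{2} \int_{\mathbb{R}} Q^2\, dx$. -/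
open MeasureTheory

namespace SchwartzMap

theorem integrable_mul_s7 (f g : SchwartzMap ℝ ℝ) : Integrable fun x : ℝ => f x * g x :=
  (pairing (ContinuousLinearMap.mul ℝ ℝ) f g).integrable

theorem integrable_id_mul_mul_s7 (f g : SchwartzMap ℝ ℝ) :
    Integrable fun x : ℝ => x * (f x * g x) := by
  have h := (pairing (ContinuousLinearMap.mul ℝ ℝ) f g).integrable_pow_mul volume 1
  refine (integrable_norm_iff ?_).1 ?_
  · exact (continuous_id.mul (f.continuous.mul g.continuous)).aestronglyMeasurable
  · simpa using h

theorem exists_coe_eq_iteratedDeriv (f : SchwartzMap ℝ ℝ) (n : ℕ) :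
    ∃ g : SchwartzMap ℝ ℝ, ⇑g = iteratedDeriv n f := by
  induction n with
  | zero => exact ⟨f, by simp⟩
  | succ n ih =>
    obtain ⟨g, hg⟩ := ih
    refine ⟨derivCLM ℝ ℝ g, ?_⟩
    ext x
    rw [derivCLM_apply, iteratedDeriv_succ, hg]

end SchwartzMap

/-- Identity obtained by eliminating the `∫ Q^{p+2}` terms from the energy
identity and the Pohozaev identity for the solitary-wave ODE. -/
theorem solitary_wave_combined_identity
    (α κ β c : ℝ) (p : ℕ)
    (hα : 0 < α) (hκ : 0 < κ) (hp : 1 ≤ p)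
    (Q : SchwartzMap ℝ ℝ)
    (hQ : ∀ x : ℝ,
      κ * c ^ 2 * iteratedDeriv 4 (⇑Q) x + (α - c ^ 2) * iteratedDeriv 2 (⇑Q) x
        + (c ^ 2 - 1) * Q x = β * (Q x) ^ (p + 1)) :
    κ * c ^ 2 * (3 * (p : ℝ) / 2 + 4) * (∫ x : ℝ, (iteratedDeriv 2 (⇑Q) x) ^ 2)
      + (c ^ 2 - α) * (((p : ℝ) + 4) / 2) * (∫ x : ℝ, (deriv (⇑Q) x) ^ 2)
      = (c ^ 2 - 1) * ((p : ℝ) / 2) * ∫ x : ℝ, (Q x) ^ 2 := by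
  obtain ⟨Q₁, h₁⟩ := Q.exists_coe_eq_iteratedDeriv 1
  obtain ⟨Q₂, h₂⟩ := Q.exists_coe_eq_iteratedDeriv 2
  obtain ⟨Q₃, h₃⟩ := Q.exists_coe_eq_iteratedDeriv 3
  obtain ⟨Q₄, h₄⟩ := Q.exists_coe_eq_iteratedDeriv 4
  have d₀ (x : ℝ) : HasDerivAt Q (Q₁ x) x := by
    simpa [h₁] using Q.hasDerivAt x
  have d₁ (x : ℝ) : HasDerivAt Q₁ (Q₂ x) x := by
    simpa only [h₂, iteratedDeriv_succ (n := 1), ← h₁] using Q₁.hasDerivAt x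
  have d₂ (x : ℝ) : HasDerivAt Q₂ (Q₃ x) x := by
    simpa only [h₃, iteratedDeriv_succ (n := 2), ← h₂] using Q₂.hasDerivAt x
  have d₃ (x : ℝ) : HasDerivAt Q₃ (Q₄ x) x := by
    simpa only [h₄, iteratedDeriv_succ (n := 3), ← h₃] using Q₃.hasDerivAt x
  rw [← iteratedDeriv_one, ← h₁, ← h₂]
  rw [← h₂, ← h₄] at hQ
  set A := κ * c ^ 2
  set B := α - c ^ 2
  set C := c ^ 2 - 1
  rw [show c ^ 2 - α = -B by ring]
  let F : ℝ → ℝ := fun x =>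
    ((p : ℝ) + 2) * (A * (x * (Q₁ x * Q₃ x) - Q₁ x * Q₂ x - x * (Q₂ x * Q₂ x) / 2)
      + B * (x * (Q₁ x * Q₁ x)) / 2 + C * (x * (Q x * Q x)) / 2)
      + A * (Q x * Q₃ x - Q₁ x * Q₂ x) + B * (Q x * Q₁ x) - β * (x * Q x ^ (p + 2))
  let G : ℝ → ℝ := fun x =>
    A * (3 * (p : ℝ) / 2 + 4) * Q₂ x ^ 2 + -B * (((p : ℝ) + 4) / 2) * Q₁ x ^ 2
      - C * ((p : ℝ) / 2) * Q x ^ 2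
  have i₀ : Integrable fun x => Q x ^ 2 := by simpa only [sq] using Q.integrable_mul_s7 Q
  have i₁ : Integrable fun x => Q₁ x ^ 2 := by simpa only [sq] using Q₁.integrable_mul_s7 Q₁
  have i₂ : Integrable fun x => Q₂ x ^ 2 := by simpa only [sq] using Q₂.integrable_mul_s7 Q₂
  have hF (x : ℝ) : HasDerivAt F (-G x) x := by
    have hx := hasDerivAt_id' x
    have H := ((((((hx.fun_mul ((d₁ x).fun_mul (d₃ x))).fun_sub ((d₁ x).fun_mul (d₂ x))).fun_sub
      ((hx.fun_mul ((d₂ x).fun_mul (d₂ x))).div_const 2)).const_mul A).fun_add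
      (((hx.fun_mul ((d₁ x).fun_mul (d₁ x))).const_mul B).div_const 2)).fun_add
      (((hx.fun_mul ((d₀ x).fun_mul (d₀ x))).const_mul C).div_const 2)).const_mul ((p : ℝ) + 2)
    have K := ((H.fun_add ((((d₀ x).fun_mul (d₃ x)).fun_sub
      ((d₁ x).fun_mul (d₂ x))).const_mul A)).fun_add
      (((d₀ x).fun_mul (d₁ x)).const_mul B)).fun_sub
      ((hx.fun_mul ((d₀ x).fun_pow (p + 2))).const_mul β)
    refine K.congr_deriv ?_
    simp only [G, show p + 2 - 1 = p + 1 by omega]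
    push_cast
    linear_combination (((p : ℝ) + 2) * x * Q₁ x + Q x) * hQ x
  have hFi : Integrable F := by
    have e : F = fun x =>
      ((p : ℝ) + 2) * (A * (x * (Q₁ x * Q₃ x) - Q₁ x * Q₂ x - x * (Q₂ x * Q₂ x) / 2)
        + B * (x * (Q₁ x * Q₁ x)) / 2 + C * (x * (Q x * Q x)) / 2)
        + A * (Q x * Q₃ x - Q₁ x * Q₂ x) + B * (Q x * Q₁ x)
        - (A * (x * (Q x * Q₄ x)) + B * (x * (Q x * Q₂ x)) + C * (x * (Q x * Q x))) := by
      ext x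
      simp only [F]
      linear_combination x * Q x * hQ x
    rw [e]
    have m := fun f g : SchwartzMap ℝ ℝ => f.integrable_mul_s7 g
    have n := fun f g : SchwartzMap ℝ ℝ => f.integrable_id_mul_mul_s7 g
    exact ((((((((n Q₁ Q₃).sub (m Q₁ Q₂)).sub ((n Q₂ Q₂).div_const 2)).const_mul A).add
      (((n Q₁ Q₁).const_mul B).div_const 2)).add
      (((n Q Q).const_mul C).div_const 2)).const_mul ((p : ℝ) + 2)).add
      (((m Q Q₃).sub (m Q₁ Q₂)).const_mul A) |>.add ((m Q Q₁).const_mul B)).sub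
      ((((n Q Q₄).const_mul A).add ((n Q Q₂).const_mul B)).add ((n Q Q).const_mul C))
  have j₂ := i₂.const_mul (A * (3 * (p : ℝ) / 2 + 4))
  have j₁ := i₁.const_mul (-B * (((p : ℝ) + 4) / 2))
  have j₀ := i₀.const_mul (C * ((p : ℝ) / 2))
  have hG : Integrable G := (j₂.add j₁).sub j₀
  have key := integral_eq_zero_of_hasDerivAt_of_integrable hF hG.neg hFi
  have hsum : ∫ x, G x = (∫ x, A * (3 * (p : ℝ) / 2 + 4) * Q₂ x ^ 2)
      + (∫ x, -B * (((p : ℝ) + 4) / 2) * Q₁ x ^ 2) - ∫ x, C * ((p : ℝ) / 2) * Q x ^ 2 := by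
    rw [← integral_add j₂ j₁]
    exact integral_sub (j₂.add j₁) j₀
  rw [integral_neg, neg_eq_zero, hsum, integral_const_mul, integral_const_mul,
    integral_const_mul] at key
  exact sub_eq_zero.1 key
end

section
/- Let $\alpha > 0$, $\kappa > 0$, $\beta \in \mathbb{R}$, and let $p \ge 1$ be an integer. Let $c \in \mathbb{R}$ satisfy $c^2 < 1$, $c^2 \neq \alpha$, and $\dfrac{\kappa (1 - c^2) c^2}{(c^2 - \alpha)^2} > \dfrac{(p+4)^2}{4p(3p+8)}$. If $Q$ is a real-valued Schwartz function on $\mathbb{R}$ satisfying $\kappa c^2 Q'''' + (\alpha - c^2) Q'' + (c^2 - 1) Q = \beta Q^{p+1}$ on all of $\mathbb{R}$, then $Q \equiv 0$. -/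
open Filter Topology

/-- A function on the line that vanishes at infinity and has a derivative of constant sign has
zero derivative. -/
theorem derivative_eq_zero_of_nonneg_of_tendsto_cocompact {F F' : ℝ → ℝ}
    (hF : ∀ x, HasDerivAt F (F' x) x) (hF' : ∀ x, 0 ≤ F' x)
    (hlim : Tendsto F (cocompact ℝ) (𝓝 0)) (x : ℝ) : F' x = 0 := by
  have hmono : Monotone F := monotone_of_deriv_nonneg (fun x => (hF x).differentiableAt)
    fun x => (hF x).deriv.symm ▸ hF' x
  have hzero : F = fun _ => 0 := funext fun y => le_antisymm
    (hmono.ge_of_tendsto (hlim.mono_left atTop_le_cocompact) y)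
    (hmono.le_of_tendsto (hlim.mono_left atBot_le_cocompact) y)
  have h := hF x
  rw [hzero] at h
  exact h.unique (hasDerivAt_const x 0)

theorem SchwartzMap.tendsto_id_mul_cocompact (f : SchwartzMap ℝ ℝ) :
    Tendsto (fun x => x * f x) (cocompact ℝ) (𝓝 0) := by
  have hid : Function.HasTemperateGrowth (fun x : ℝ => x) := by fun_prop
  refine (SchwartzMap.smulLeftCLM ℝ (fun x : ℝ => x) f).tendsto_cocompact.congr fun x => ?_
  rw [SchwartzMap.smulLeftCLM_apply_apply hid, smul_eq_mul]

/-- Differential form of the Pohozaev identity obtained by testing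
`a q'''' + b q'' + d q = β q ^ (p + 1)` against `2 q + 2 (p + 2) x q'`. -/
theorem hasDerivAt_pohozaev_flux {a b d β : ℝ} {p : ℕ} {q₀ q₁ q₂ q₃ q₄ : ℝ → ℝ} {x : ℝ}
    (h₀ : HasDerivAt q₀ (q₁ x) x) (h₁ : HasDerivAt q₁ (q₂ x) x)
    (h₂ : HasDerivAt q₂ (q₃ x) x) (h₃ : HasDerivAt q₃ (q₄ x) x)
    (hq : a * q₄ x + b * q₂ x + d * q₀ x = β * q₀ x ^ (p + 1)) :
    HasDerivAt (fun y => 2 * β * ((y * q₀ y) * q₀ y ^ (p + 1))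
        - 2 * a * (q₀ y * q₃ y - q₁ y * q₂ y)
        - (p + 2) * a * (2 * ((y * q₁ y) * q₃ y) - 2 * (q₁ y * q₂ y) - (y * q₂ y) * q₂ y)
        - (p + 2) * b * ((y * q₁ y) * q₁ y - q₀ y * q₁ y)
        - (p + 2) * d * ((y * q₀ y) * q₀ y))
      ((3 * p + 8) * a * q₂ x ^ 2 + (p + 4) * b * (q₂ x * q₀ x) + p * (-d) * q₀ x ^ 2) x := by
  have hx := hasDerivAt_id' x
  have hd := (((((((hx.mul h₀).mul (h₀.pow (p + 1))).const_mul (2 * β)).sub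
    (((h₀.mul h₃).sub (h₁.mul h₂)).const_mul (2 * a))).sub
    ((((((hx.mul h₁).mul h₃).const_mul 2).sub ((h₁.mul h₂).const_mul 2)).sub
      ((hx.mul h₂).mul h₂)).const_mul ((p + 2) * a))).sub
    ((((hx.mul h₁).mul h₁).sub (h₀.mul h₁)).const_mul ((p + 2) * b))).sub
    (((hx.mul h₀).mul h₀).const_mul ((p + 2) * d)))
  refine hd.congr_deriv ?_
  simp only [Pi.mul_apply, Pi.pow_apply, Nat.add_sub_cancel]
  push_cast
  linear_combination (-2 * q₀ x - 2 * (p + 2) * x * q₁ x) * hq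

theorem tendsto_pohozaev_flux (a b d β : ℝ) (p : ℕ) (q₀ q₁ q₂ q₃ : SchwartzMap ℝ ℝ) :
    Tendsto (fun y => 2 * β * ((y * q₀ y) * q₀ y ^ (p + 1))
        - 2 * a * (q₀ y * q₃ y - q₁ y * q₂ y)
        - (p + 2) * a * (2 * ((y * q₁ y) * q₃ y) - 2 * (q₁ y * q₂ y) - (y * q₂ y) * q₂ y)
        - (p + 2) * b * ((y * q₁ y) * q₁ y - q₀ y * q₁ y)
        - (p + 2) * d * ((y * q₀ y) * q₀ y)) (cocompact ℝ) (𝓝 0) := by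
  have t₀ := q₀.tendsto_cocompact
  have t₁ := q₁.tendsto_cocompact
  have t₂ := q₂.tendsto_cocompact
  have t₃ := q₃.tendsto_cocompact
  have s₀ := q₀.tendsto_id_mul_cocompact
  have s₁ := q₁.tendsto_id_mul_cocompact
  have s₂ := q₂.tendsto_id_mul_cocompact
  have h := (((((((s₀.mul (t₀.pow (p + 1))).const_mul (2 * β)).sub
    (((t₀.mul t₃).sub (t₁.mul t₂)).const_mul (2 * a))).sub
    (((((s₁.mul t₃).const_mul 2).sub ((t₁.mul t₂).const_mul 2)).sub
      (s₂.mul t₂)).const_mul ((p + 2) * a))).sub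
    (((s₁.mul t₁).sub (t₀.mul t₁)).const_mul ((p + 2) * b))).sub
    ((s₀.mul t₀).const_mul ((p + 2) * d))))
  simpa using h

/-- A real Schwartz solution of `a q'''' + b q'' + d q = β q ^ (p + 1)` vanishes when the quadratic
form in the combined Pohozaev identity is positive definite. -/
theorem SchwartzMap.eq_zero_of_fourth_order_ode {a b d β : ℝ} {p : ℕ} (ha : 0 < a)
    (hdisc : ((p + 4) * b) ^ 2 < 4 * ((3 * p + 8) * a) * (p * (-d)))
    (q : SchwartzMap ℝ ℝ)
    (hq : ∀ x : ℝ, a * iteratedDeriv 4 q x + b * iteratedDeriv 2 q x + d * q x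
      = β * q x ^ (p + 1)) (x : ℝ) : q x = 0 := by
  set D := SchwartzMap.derivCLM ℝ ℝ
  have hD (f : SchwartzMap ℝ ℝ) : ⇑(D f) = deriv f := funext (SchwartzMap.derivCLM_apply ℝ f)
  have hder (f : SchwartzMap ℝ ℝ) (y : ℝ) : HasDerivAt f (D f y) y := hD f ▸ f.hasDerivAt y
  have h2 : iteratedDeriv 2 q = D (D q) := by
    simp [iteratedDeriv_succ, hD]
  have h4 : iteratedDeriv 4 q = D (D (D (D q))) := by
    simp [iteratedDeriv_succ, hD]
  rw [h2, h4] at hq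
  have hA : 0 < (3 * p + 8) * a := by positivity
  have hsq (y : ℝ) : 4 * ((3 * p + 8) * a) * ((3 * p + 8) * a * D (D q) y ^ 2
      + (p + 4) * b * (D (D q) y * q y) + p * (-d) * q y ^ 2)
      = (2 * ((3 * p + 8) * a) * D (D q) y + (p + 4) * b * q y) ^ 2
        + (4 * ((3 * p + 8) * a) * (p * (-d)) - ((p + 4) * b) ^ 2) * q y ^ 2 := by ring
  have hform := derivative_eq_zero_of_nonneg_of_tendsto_cocompact
    (fun y => hasDerivAt_pohozaev_flux (hder q y) (hder (D q) y) (hder (D (D q)) y)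
      (hder (D (D (D q))) y) (hq y))
    (fun y => by
      refine nonneg_of_mul_nonneg_right ((hsq y).symm ▸ ?_)
        (mul_pos four_pos hA)
      exact add_nonneg (sq_nonneg _) (mul_nonneg (sub_nonneg.2 hdisc.le) (sq_nonneg _)))
    (tendsto_pohozaev_flux a b d β p q (D q) (D (D q)) (D (D (D q)))) x
  have h := hsq x
  rw [hform, mul_zero] at h
  have hle : (4 * ((3 * p + 8) * a) * (p * (-d)) - ((p + 4) * b) ^ 2) * q x ^ 2 ≤ 0 := by
    linarith [sq_nonneg (2 * ((3 * p + 8) * a) * D (D q) x + (p + 4) * b * q x)]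
  exact pow_eq_zero_iff two_ne_zero |>.1
    (le_antisymm (nonpos_of_mul_nonpos_right hle (sub_pos.2 hdisc)) (sq_nonneg _))

/-- Extended non-existence of solitary waves under a quantitative condition on
`κ`, `α`, `c` and `p`. -/
theorem no_solitary_wave_extended
    (α κ β c : ℝ) (p : ℕ)
    (hα : 0 < α) (hκ : 0 < κ) (hp : 1 ≤ p)
    (hc1 : c ^ 2 < 1) (hc2 : c ^ 2 ≠ α)
    (hcond : (p + 4 : ℝ) ^ 2 / (4 * (p : ℝ) * (3 * (p : ℝ) + 8))
        < κ * (1 - c ^ 2) * c ^ 2 / (c ^ 2 - α) ^ 2)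
    (Q : SchwartzMap ℝ ℝ)
    (hQ : ∀ x : ℝ,
      κ * c ^ 2 * iteratedDeriv 4 (⇑Q) x + (α - c ^ 2) * iteratedDeriv 2 (⇑Q) x
        + (c ^ 2 - 1) * Q x = β * (Q x) ^ (p + 1)) :
    ∀ x : ℝ, Q x = 0 := by
  have hp' : (0 : ℝ) < p := by exact_mod_cast hp
  have hc : c ≠ 0 := by
    rintro rfl
    have : 0 ≤ (p + 4 : ℝ) ^ 2 / (4 * (p : ℝ) * (3 * (p : ℝ) + 8)) := by positivity
    exact this.not_gt (by simpa using hcond)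
  have hb : 0 < (c ^ 2 - α) ^ 2 := sq_pos_of_ne_zero (sub_ne_zero.2 hc2)
  rw [div_lt_div_iff₀ (by positivity) hb] at hcond
  exact Q.eq_zero_of_fourth_order_ode (by positivity) (by linarith) hQ
end

section
/- Let $\kappa > 1/4$ and set $\sigma = \frac{1}{2}\sqrt{\frac{2}{\sqrt{\kappa}} + \frac{1}{\kappa}}$ and $\omega = \frac{1}{2}\sqrt{\frac{2}{\sqrt{\kappa}} - \frac{1}{\kappa}}$. Define $K(x) = \dfrac{\kappa\pi\, e^{-\sigma|x|}}{2\sigma\omega(\sigma^2 + \omega^2)} \left( \omega \cos(\omega x) + \sigma \sin(\omega |x|) \right)$. Then for every $\xi \in \mathbb{R}$, $\int_{\mathbb{R}} K(x)\, e^{-i\xi x}\, dx = \dfrac{2\pi\kappa^2}{1 + \xi^2 + \kappa \xi^4}$. -/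
open MeasureTheory

open Complex Set in
/-- The Laplace kernel `x ↦ exp (-s|x|)` with `0 < re s`: integrability and Fourier transform. -/
theorem integrable_and_integral_exp_neg_mul_abs {s : ℂ} (hs : 0 < s.re) (ξ : ℝ) :
    Integrable (fun x : ℝ => exp (-s * (|x| : ℝ)) * exp (-(I * ξ * x))) ∧
      ∫ x : ℝ, exp (-s * (|x| : ℝ)) * exp (-(I * ξ * x)) = 2 * s / (s ^ 2 + (ξ : ℂ) ^ 2) := by
  have hre_neg : (-s - I * ξ).re < 0 := by simpa using hs
  have hre_pos : 0 < (s - I * ξ).re := by simpa using hs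
  have h_Ioi : EqOn (fun x : ℝ => exp ((-s - I * ξ) * x))
      (fun x : ℝ => exp (-s * (|x| : ℝ)) * exp (-(I * ξ * x))) (Ioi 0) := by
    intro x hx
    simp only [abs_of_pos (mem_Ioi.mp hx), ← Complex.exp_add]
    ring_nf
  have h_Iic : EqOn (fun x : ℝ => exp ((s - I * ξ) * x))
      (fun x : ℝ => exp (-s * (|x| : ℝ)) * exp (-(I * ξ * x))) (Iic 0) := by
    intro x hx
    simp only [abs_of_nonpos (mem_Iic.mp hx), ← Complex.exp_add]
    push_cast
    ring_nf
  have hint_Ioi := (integrableOn_exp_mul_complex_Ioi hre_neg 0).congr_fun h_Ioi measurableSet_Ioi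
  have hint_Iic := (integrableOn_exp_mul_complex_Iic hre_pos 0).congr_fun h_Iic measurableSet_Iic
  constructor
  · rw [← integrableOn_univ, ← Iic_union_Ioi (a := (0 : ℝ))]
    exact hint_Iic.union hint_Ioi
  · rw [← intervalIntegral.integral_Iic_add_Ioi hint_Iic hint_Ioi,
      ← setIntegral_congr_fun measurableSet_Iic h_Iic,
      ← setIntegral_congr_fun measurableSet_Ioi h_Ioi,
      integral_exp_mul_complex_Iic hre_pos, integral_exp_mul_complex_Ioi hre_neg]
    have hsub : s - I * ξ ≠ 0 := fun h => by simp [h] at hre_pos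
    have hadd : s + I * ξ ≠ 0 := fun h => by
      rw [show -s - I * ξ = -(s + I * ξ) by ring, h] at hre_neg
      simp at hre_neg
    have hfac : s ^ 2 + (ξ : ℂ) ^ 2 = (s - I * ξ) * (s + I * ξ) := by
      linear_combination (ξ : ℂ) ^ 2 * I_sq
    rw [hfac, show -s - I * ξ = -(s + I * ξ) by ring]
    simp only [ofReal_zero, mul_zero, Complex.exp_zero]
    rw [neg_div_neg_eq, div_add_div _ _ hsub hadd]
    ring

open Complex in
/-- Fourier transform of an exponentially damped oscillation, as a real rational function. -/
theorem integral_damped_oscillation {σ ω : ℝ} (hσ : 0 < σ) (hω : 0 < ω) (ξ : ℝ) :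
    ∫ x : ℝ, ((Real.exp (-σ * |x|) * (ω * Real.cos (ω * x) + σ * Real.sin (ω * |x|)) : ℝ) : ℂ) *
        exp (-(I * ξ * x)) =
      ((4 * σ * ω * (σ ^ 2 + ω ^ 2) /
        (ξ ^ 4 + 2 * (σ ^ 2 - ω ^ 2) * ξ ^ 2 + (σ ^ 2 + ω ^ 2) ^ 2) : ℝ) : ℂ) := by
  set s : ℂ := σ - I * ω with hs
  set t : ℂ := σ + I * ω with ht
  obtain ⟨hints, hs_int⟩ := integrable_and_integral_exp_neg_mul_abs (s := s) (by simpa [hs]) ξ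
  obtain ⟨hintt, ht_int⟩ := integrable_and_integral_exp_neg_mul_abs (s := t) (by simpa [ht]) ξ
  have hpoint (x : ℝ) :
      ((Real.exp (-σ * |x|) * (ω * Real.cos (ω * x) + σ * Real.sin (ω * |x|)) : ℝ) : ℂ) *
        exp (-(I * ξ * x)) =
      (-I * t / 2) * (exp (-s * (|x| : ℝ)) * exp (-(I * ξ * x))) +
        (I * s / 2) * (exp (-t * (|x| : ℝ)) * exp (-(I * ξ * x))) := by
    have hcos : Real.cos (ω * x) = Real.cos (ω * |x|) := by
      rw [← Real.cos_abs (ω * x), abs_mul, abs_of_pos hω]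
    rw [hcos, show -s * ((|x| : ℝ) : ℂ) = -σ * (|x| : ℝ) + (ω * (|x| : ℝ)) * I by rw [hs]; ring,
      show -t * ((|x| : ℝ) : ℂ) = -σ * (|x| : ℝ) + (-(ω * (|x| : ℝ))) * I by rw [ht]; ring,
      Complex.exp_add, Complex.exp_add, exp_mul_I, exp_mul_I, Complex.cos_neg, Complex.sin_neg,
      hs, ht]
    push_cast
    linear_combination (exp (-σ * (|x| : ℝ)) * exp (-(I * ξ * x)) *
      (ω * Complex.cos (ω * (|x| : ℝ)) + σ * Complex.sin (ω * (|x| : ℝ)))) * I_sq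
  have hden : ((ξ ^ 4 + 2 * (σ ^ 2 - ω ^ 2) * ξ ^ 2 + (σ ^ 2 + ω ^ 2) ^ 2 : ℝ) : ℂ) =
      (s ^ 2 + (ξ : ℂ) ^ 2) * (t ^ 2 + (ξ : ℂ) ^ 2) := by
    apply Complex.ext <;> simp [hs, ht, pow_succ] <;> ring
  have hne : ((ξ ^ 4 + 2 * (σ ^ 2 - ω ^ 2) * ξ ^ 2 + (σ ^ 2 + ω ^ 2) ^ 2 : ℝ) : ℂ) ≠ 0 := by
    rw [show ξ ^ 4 + 2 * (σ ^ 2 - ω ^ 2) * ξ ^ 2 + (σ ^ 2 + ω ^ 2) ^ 2 =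
      (ξ ^ 2 + σ ^ 2 - ω ^ 2) ^ 2 + 4 * σ ^ 2 * ω ^ 2 by ring]
    exact ofReal_ne_zero.mpr (by positivity)
  obtain ⟨hs0, ht0⟩ := mul_ne_zero_iff.mp (hden ▸ hne)
  simp_rw [hpoint]
  rw [integral_add (hints.const_mul _) (hintt.const_mul _), integral_const_mul,
    integral_const_mul, hs_int, ht_int, ofReal_div, hden]
  have hnum : ((4 * σ * ω * (σ ^ 2 + ω ^ 2) : ℝ) : ℂ) = -I * s * t * (t ^ 2 - s ^ 2) := by
    rw [hs, ht]
    push_cast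
    linear_combination (4 * σ * ω * (σ ^ 2 + (1 - I ^ 2) * ω ^ 2) : ℂ) * I_sq
  rw [hnum]
  field_simp
  ring

/-- Fourier transform of the kernel of `(I - ∂ₓ² + κ∂ₓ⁴)⁻¹` in the regime
`4κ > 1`. -/
theorem kernel_fourier_transform_large_kappa
    (κ : ℝ) (hκ : 1 / 4 < κ)
    (σ ω : ℝ)
    (hσ : σ = (1 / 2) * Real.sqrt (2 / Real.sqrt κ + 1 / κ))
    (hω : ω = (1 / 2) * Real.sqrt (2 / Real.sqrt κ - 1 / κ))
    (K : ℝ → ℝ)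
    (hK : ∀ x : ℝ, K x = κ * Real.pi * Real.exp (-σ * |x|) /
        (2 * σ * ω * (σ ^ 2 + ω ^ 2)) *
        (ω * Real.cos (ω * x) + σ * Real.sin (ω * |x|))) :
    ∀ ξ : ℝ, ∫ x : ℝ, (K x : ℂ) * Complex.exp (-(Complex.I * ξ * x)) =
      ((2 * Real.pi * κ ^ 2 / (1 + ξ ^ 2 + κ * ξ ^ 4) : ℝ) : ℂ) := by
  have hκ0 : 0 < κ := by linarith
  have hsq : Real.sqrt κ ^ 2 = κ := Real.sq_sqrt hκ0.le
  have hr : 1 / 2 < Real.sqrt κ := Real.lt_sqrt_of_sq_lt (by linarith)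
  generalize Real.sqrt κ = r at *
  have hr0 : 0 < r := by linarith
  have hminus : 0 < 2 / r - 1 / κ := by
    rw [show 2 / r - 1 / κ = (2 * r - 1) / κ by rw [← hsq]; field_simp]
    exact div_pos (by linarith) hκ0
  have hplus : 0 < 2 / r + 1 / κ := by positivity
  have hσ0 : 0 < σ := by rw [hσ]; positivity
  have hω0 : 0 < ω := by rw [hω]; positivity
  have hσ2 : σ ^ 2 = (2 / r + 1 / κ) / 4 := by
    rw [hσ, mul_pow, Real.sq_sqrt hplus.le]; ring
  have hω2 : ω ^ 2 = (2 / r - 1 / κ) / 4 := by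
    rw [hω, mul_pow, Real.sq_sqrt hminus.le]; ring
  have hsum : (σ ^ 2 + ω ^ 2) ^ 2 = 1 / κ := by
    rw [hσ2, hω2, ← hsq]; field_simp; ring
  have hdiff : 2 * (σ ^ 2 - ω ^ 2) = 1 / κ := by rw [hσ2, hω2]; ring
  intro ξ
  have hpoint (x : ℝ) : (K x : ℂ) * Complex.exp (-(Complex.I * ξ * x)) =
      ((κ * Real.pi / (2 * σ * ω * (σ ^ 2 + ω ^ 2)) : ℝ) : ℂ) *
        (((Real.exp (-σ * |x|) * (ω * Real.cos (ω * x) + σ * Real.sin (ω * |x|)) : ℝ) : ℂ) *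
          Complex.exp (-(Complex.I * ξ * x))) := by
    rw [hK, ← mul_assoc, ← Complex.ofReal_mul]
    congr 2
    ring
  simp_rw [hpoint]
  rw [integral_const_mul, integral_damped_oscillation hσ0 hω0, ← Complex.ofReal_mul, hsum, hdiff]
  congr 1
  have hden : ξ ^ 4 + 1 / κ * ξ ^ 2 + 1 / κ = (1 + ξ ^ 2 + κ * ξ ^ 4) / κ := by
    field_simp
    ring
  have hpos : 0 < 1 + ξ ^ 2 + κ * ξ ^ 4 := by positivity
  rw [hden]
  field_simp
  ring
end

section
/- Let $c^2 = 169/133$ and define $Q(\xi) = \dfrac{15}{38}\, \operatorname{sech}^4\!\left( \dfrac{\xi}{2\sqrt{13}} \right)$. Then $Q$ satisfies $c^2 Q''''(\xi) - c^2 Q''(\xi) + (c^2 - 1) Q(\xi) = Q(\xi)^2$ for every $\xi \in \mathbb{R}$. -/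
/-- The derivative of `sechⁿ (a x)`. -/
theorem hasDerivAt_inv_cosh_pow (a : ℝ) (n : ℕ) (x : ℝ) :
    HasDerivAt (fun y => (Real.cosh (y * a))⁻¹ ^ n)
      (-(n * a) * (Real.sinh (x * a) * (Real.cosh (x * a))⁻¹ ^ (n + 1))) x := by
  have hc : Real.cosh (x * a) ≠ 0 := (Real.cosh_pos _).ne'
  have h := ((((hasDerivAt_id x).mul_const a).cosh).inv hc).pow n
  refine h.congr_deriv ?_
  cases n with
  | zero => simp
  | succ k =>
    simp only [id, Pi.inv_apply, Nat.add_sub_cancel]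
    ring

/-- The second derivative of `sechⁿ (a x)`, in terms of powers of `sech (a x)`. -/
theorem iteratedDeriv_two_inv_cosh_pow (a : ℝ) (n : ℕ) :
    iteratedDeriv 2 (fun y => (Real.cosh (y * a))⁻¹ ^ n) =
      fun x => a ^ 2 * (n ^ 2 * (Real.cosh (x * a))⁻¹ ^ n
        - n * (n + 1) * (Real.cosh (x * a))⁻¹ ^ (n + 2)) := by
  rw [iteratedDeriv_succ, iteratedDeriv_one,
    funext fun x => (hasDerivAt_inv_cosh_pow a n x).deriv]
  funext x
  have hu := mul_inv_cancel₀ (Real.cosh_pos (x * a)).ne'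
  have h := ((((hasDerivAt_id x).mul_const a).sinh).mul
    (hasDerivAt_inv_cosh_pow a (n + 1) x)).const_mul (-(n * a))
  refine (h.congr_deriv ?_).deriv
  have hs := Real.sinh_sq (x * a)
  simp only [id]
  push_cast
  generalize (Real.cosh (x * a))⁻¹ = u at hu ⊢
  linear_combination (n * (n + 1) * a ^ 2 * u ^ (n + 2)) * hs
    + (n * a ^ 2 * u ^ n * ((n + 1) * (Real.cosh (x * a) * u) + n)) * hu

/-- The exact HBq solitary wave `Q(ξ) = (15/38) sech⁴(ξ/(2√13))` with speed
`c² = 169/133` satisfies the profile equation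
`c² Q'''' - c² Q'' + (c² - 1) Q = Q²`. -/
theorem hbq_exact_solitary_wave
    (c : ℝ) (hc : c ^ 2 = 169 / 133)
    (Q : ℝ → ℝ)
    (hQ : ∀ ξ : ℝ, Q ξ = (15 / 38) * ((Real.cosh (ξ / (2 * Real.sqrt 13)))⁻¹) ^ 4) :
    ∀ ξ : ℝ, c ^ 2 * iteratedDeriv 4 Q ξ - c ^ 2 * iteratedDeriv 2 Q ξ
      + (c ^ 2 - 1) * Q ξ = (Q ξ) ^ 2 := by
  intro ξ
  set a : ℝ := (2 * Real.sqrt 13)⁻¹ with ha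
  have ha2 : a ^ 2 = 1 / 52 := by
    rw [ha, inv_pow, mul_pow, Real.sq_sqrt (by norm_num)]
    norm_num
  have hQ' : Q = fun y => (15 / 38) * (Real.cosh (y * a))⁻¹ ^ 4 := by
    funext y
    rw [hQ, div_eq_mul_inv y]
  have hsmooth (n : ℕ) (x : ℝ) :
      ContDiffAt ℝ 2 (fun y => (Real.cosh (y * a))⁻¹ ^ n) x :=
    ((by fun_prop : ContDiffAt ℝ 2 (fun y => Real.cosh (y * a)) x).inv
      (Real.cosh_pos _).ne').pow n
  have h2 : iteratedDeriv 2 Q = fun x =>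
      (15 / 38) * (1 / 52) * 16 * (Real.cosh (x * a))⁻¹ ^ 4
        - (15 / 38) * (1 / 52) * 20 * (Real.cosh (x * a))⁻¹ ^ 6 := by
    funext x
    rw [hQ', iteratedDeriv_const_mul_field, iteratedDeriv_two_inv_cosh_pow, ha2]
    push_cast
    ring
  have h4 : iteratedDeriv 4 Q = iteratedDeriv 2 (iteratedDeriv 2 Q) := by
    simp only [iteratedDeriv_succ, iteratedDeriv_zero]
  rw [h4, h2, iteratedDeriv_fun_sub (contDiffAt_const.mul (hsmooth 4 ξ))
      (contDiffAt_const.mul (hsmooth 6 ξ)),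
    iteratedDeriv_const_mul_field, iteratedDeriv_const_mul_field,
    iteratedDeriv_two_inv_cosh_pow, iteratedDeriv_two_inv_cosh_pow, ha2, hc, hQ']
  push_cast
  ring
end
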